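/- Let Φ be a partially monotone norm on ℝ^{n+1}, Ω̂ ⊆ ℝ^n an open set, and u ∈ M_{Φ^o}(Ω̂). Then u is locally essentially bounded in Ω̂, i.e. for every open set A compactly contained in Ω̂ there is M > 0 with |u| ≤ M almost everywhere on A. -/

import Mathlib

open MeasureTheory Set Filter

noncomputable section

/-- `ℝ^n` with the Euclidean norm. -/
abbrev Rn (n : ℕ) := EuclideanSpace ℝ (Fin n)

/-- `ℝ^{n+1} = ℝ^n × ℝ`. -/
abbrev Rn1 (n : ℕ) := Rn n × ℝ

/-- Euclidean dot product on `ℝ^n`. -/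
def dotn {n : ℕ} (x y : Rn n) : ℝ := ∑ i, x i * y i

/-- Euclidean dot product on `ℝ^{n+1} = ℝ^n × ℝ`. -/
def dotp {n : ℕ} (x y : Rn1 n) : ℝ := dotn x.1 y.1 + x.2 * y.2

/-- Euclidean norm on `ℝ^{n+1} = ℝ^n × ℝ`. -/
def enorm1 {n : ℕ} (x : Rn1 n) : ℝ := Real.sqrt (dotp x x)

/-- `Ψ` is a norm on `ℝ^n`: convex, absolutely one-homogeneous and bounded
below by a positive multiple of the Euclidean norm. -/
def IsNormN {n : ℕ} (Ψ : Rn n → ℝ) : Prop :=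
  ConvexOn ℝ univ Ψ ∧ (∀ (c : ℝ) (ξ : Rn n), Ψ (c • ξ) = |c| * Ψ ξ) ∧
    ∃ c > (0:ℝ), ∀ ξ, c * ‖ξ‖ ≤ Ψ ξ

/-- `Φ` is a norm on `ℝ^{n+1}`. -/
def IsNorm1 {n : ℕ} (Φ : Rn1 n → ℝ) : Prop :=
  ConvexOn ℝ univ Φ ∧ (∀ (c : ℝ) (ξ : Rn1 n), Φ (c • ξ) = |c| * Φ ξ) ∧
    ∃ c > (0:ℝ), ∀ ξ, c * enorm1 ξ ≤ Φ ξ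

/-- Dual norm on `ℝ^n`: `Ψ^o(ξ*) = sup {ξ*·ξ : Ψ(ξ) ≤ 1}`. -/
def dualN {n : ℕ} (Ψ : Rn n → ℝ) (xs : Rn n) : ℝ :=
  sSup ((fun ξ => dotn xs ξ) '' {ξ | Ψ ξ ≤ 1})

/-- Dual norm on `ℝ^{n+1}`. -/
def dual1 {n : ℕ} (Φ : Rn1 n → ℝ) (xs : Rn1 n) : ℝ :=
  sSup ((fun ξ => dotp xs ξ) '' {ξ | Φ ξ ≤ 1})

/-- `Φ` is cylindrical over `φ`: `Φ(ξ̂,ξ_{n+1}) = max (φ(ξ̂), |ξ_{n+1}|)`. -/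
def Cylindrical {n : ℕ} (Φ : Rn1 n → ℝ) (φ : Rn n → ℝ) : Prop :=
  ∀ ξ : Rn1 n, Φ ξ = max (φ ξ.1) |ξ.2|

/-- `A` is an open set compactly contained in `O`. -/
def CpCtd {E : Type*} [TopologicalSpace E] (A O : Set E) : Prop :=
  IsOpen A ∧ IsCompact (closure A) ∧ closure A ⊆ O

/-- Divergence of a vector field on `ℝ^n`. -/
def divN {n : ℕ} (η : Rn n → Rn n) (x : Rn n) : ℝ :=
  ∑ i, fderiv ℝ η x (EuclideanSpace.single i (1:ℝ)) i

/-- Divergence of a vector field on `ℝ^{n+1} = ℝ^n × ℝ`. -/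
def div1 {n : ℕ} (η : Rn1 n → Rn1 n) (z : Rn1 n) : ℝ :=
  (∑ i, (fderiv ℝ η z (EuclideanSpace.single i (1:ℝ), (0:ℝ))).1 i) +
    (fderiv ℝ η z ((0 : Rn n), (1:ℝ))).2

/-- Admissible test vector fields on `ℝ^n`: `C^1`, compactly supported in `A`,
with values in the unit ball of `Ψ`. -/
def TestN {n : ℕ} (A : Set (Rn n)) (Ψ : Rn n → ℝ) (η : Rn n → Rn n) : Prop :=
  ContDiff ℝ 1 η ∧ HasCompactSupport η ∧ tsupport η ⊆ A ∧ ∀ x, Ψ (η x) ≤ 1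

/-- Admissible test vector fields on `ℝ^{n+1}`. -/
def Test1 {n : ℕ} (A : Set (Rn1 n)) (Φ : Rn1 n → ℝ) (η : Rn1 n → Rn1 n) : Prop :=
  ContDiff ℝ 1 η ∧ HasCompactSupport η ∧ tsupport η ⊆ A ∧ ∀ z, Φ (η z) ≤ 1

/-- The set of numbers whose supremum is the anisotropic perimeter `P_Ψ(E,A)` in `ℝ^n`. -/
def perSetN {n : ℕ} (Ψ : Rn n → ℝ) (E A : Set (Rn n)) : Set ℝ :=
  {r | ∃ η, TestN A Ψ η ∧ r = -∫ x in E, divN η x}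

/-- Anisotropic perimeter `P_Ψ(E,A)` in `ℝ^n`. -/
def PerN {n : ℕ} (Ψ : Rn n → ℝ) (E A : Set (Rn n)) : ℝ := sSup (perSetN Ψ E A)

/-- `E` has locally finite perimeter in `O ⊆ ℝ^n`. -/
def BVlocSetN {n : ℕ} (O E : Set (Rn n)) : Prop :=
  ∀ A, CpCtd A O → BddAbove (perSetN (fun x => ‖x‖) E A)

/-- `E` is a minimizer of `P_Ψ` (by compact perturbations) in `O ⊆ ℝ^n`. -/
def MinPerN {n : ℕ} (Ψ : Rn n → ℝ) (O E : Set (Rn n)) : Prop :=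
  BVlocSetN O E ∧ ∀ A, CpCtd A O → ∀ F, BVlocSetN O F →
    IsCompact (closure (symmDiff E F)) → closure (symmDiff E F) ⊆ A →
      PerN Ψ E A ≤ PerN Ψ F A

/-- The set of numbers whose supremum is the anisotropic perimeter `P_Φ(E,A)` in `ℝ^{n+1}`. -/
def perSet1 {n : ℕ} (Φ : Rn1 n → ℝ) (E A : Set (Rn1 n)) : Set ℝ :=
  {r | ∃ η, Test1 A Φ η ∧ r = -∫ z in E, div1 η z}

/-- Anisotropic perimeter `P_Φ(E,A)` in `ℝ^{n+1}`. -/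
def Per1 {n : ℕ} (Φ : Rn1 n → ℝ) (E A : Set (Rn1 n)) : ℝ := sSup (perSet1 Φ E A)

/-- `E` has locally finite perimeter in `O ⊆ ℝ^{n+1}`. -/
def BVlocSet1 {n : ℕ} (O E : Set (Rn1 n)) : Prop :=
  ∀ A, CpCtd A O → BddAbove (perSet1 enorm1 E A)

/-- `E` is a minimizer of `P_Φ` (by compact perturbations) in `O ⊆ ℝ^{n+1}`. -/
def MinPer1 {n : ℕ} (Φ : Rn1 n → ℝ) (O E : Set (Rn1 n)) : Prop :=
  BVlocSet1 O E ∧ ∀ A, CpCtd A O → ∀ F, BVlocSet1 O F →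
    IsCompact (closure (symmDiff E F)) → closure (symmDiff E F) ⊆ A →
      Per1 Φ E A ≤ Per1 Φ F A

/-- The set of numbers whose supremum is the total variation `TV(u,A)`. -/
def varSet {n : ℕ} (A : Set (Rn n)) (u : Rn n → ℝ) : Set ℝ :=
  {r | ∃ η, TestN A (fun x => ‖x‖) η ∧ r = ∫ x in A, u x * divN η x}

/-- Total variation `TV(u,A)`. -/
def TV {n : ℕ} (u : Rn n → ℝ) (A : Set (Rn n)) : ℝ := sSup (varSet A u)

/-- `u ∈ BV_loc(Ω̂)`. -/
def BVlocFun {n : ℕ} (Ω : Set (Rn n)) (u : Rn n → ℝ) : Prop :=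
  (∀ A, CpCtd A Ω → IntegrableOn u A) ∧ ∀ A, CpCtd A Ω → BddAbove (varSet A u)

/-- The set of numbers whose supremum is `G_{Φ^o}(u,A)`. -/
def Gset {n : ℕ} (Φ : Rn1 n → ℝ) (A : Set (Rn n)) (u : Rn n → ℝ) : Set ℝ :=
  {r | ∃ η : Rn n → Rn1 n, ContDiff ℝ 1 η ∧ HasCompactSupport η ∧ tsupport η ⊆ A ∧
    (∀ x, Φ (η x) ≤ 1) ∧ r = ∫ x in A, (u x * divN (fun y => (η y).1) x + (η x).2)}

/-- The functional `G_{Φ^o}(u,A)`. -/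
def Gfun {n : ℕ} (Φ : Rn1 n → ℝ) (u : Rn n → ℝ) (A : Set (Rn n)) : ℝ := sSup (Gset Φ A u)

/-- `w` has compact support contained in `A`. -/
def CptSupp {n : ℕ} (A : Set (Rn n)) (w : Rn n → ℝ) : Prop :=
  IsCompact (tsupport w) ∧ tsupport w ⊆ A

/-- `u` is a minimizer of `G_{Φ^o}` by compact perturbations in `Ω̂`,
i.e. `u ∈ M_{Φ^o}(Ω̂)`. -/
def MinG {n : ℕ} (Φ : Rn1 n → ℝ) (Ω : Set (Rn n)) (u : Rn n → ℝ) : Prop :=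
  BVlocFun Ω u ∧ ∀ A, CpCtd A Ω → ∀ v, BVlocFun Ω v →
    CptSupp A (fun x => u x - v x) → Gfun Φ u A ≤ Gfun Φ v A

/-- `u` is a minimizer of the total variation by compact perturbations in `Ω̂`. -/
def MinTV {n : ℕ} (Ω : Set (Rn n)) (u : Rn n → ℝ) : Prop :=
  BVlocFun Ω u ∧ ∀ A, CpCtd A Ω → ∀ v, BVlocFun Ω v →
    CptSupp A (fun x => u x - v x) → TV u A ≤ TV v A

/-- Subgraph of `u : Ω̂ → ℝ`. -/
def sg {n : ℕ} (Ω : Set (Rn n)) (u : Rn n → ℝ) : Set (Rn1 n) :=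
  {p | p.1 ∈ Ω ∧ p.2 < u p.1}

/-- `S` is locally a Lipschitz graph at `p`. -/
def IsLocLipGraphAt {n : ℕ} (S : Set (Rn1 n)) (p : Rn1 n) : Prop :=
  ∃ U : Set (Rn1 n), IsOpen U ∧ p ∈ U ∧ ∃ e : Rn1 n, enorm1 e = 1 ∧
    ∃ g : Rn1 n → ℝ, (∃ L : NNReal, LipschitzOnWith L g {y | dotp y e = 0}) ∧
      S ∩ U = {z | ∃ y, dotp y e = 0 ∧ z = y + g y • e} ∩ U

/-- `Φ` is a partially monotone norm on `ℝ^{n+1}`. -/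
def PartMono {n : ℕ} (Φ : Rn1 n → ℝ) : Prop :=
  ∀ ξ η : Rn1 n, Φ (ξ.1, 0) ≤ Φ (η.1, 0) → Φ ((0 : Rn n), ξ.2) ≤ Φ ((0 : Rn n), η.2) →
    Φ ξ ≤ Φ η

end

section Helpers
open scoped Convolution Topology

lemma divN_eq {n : ℕ} {η : Rn n → Rn n} {x : Rn n} (h : DifferentiableAt ℝ η x) :
    divN η x = ∑ i, fderiv ℝ (fun y => η y i) x (EuclideanSpace.single i (1:ℝ)) := by
  unfold divN
  refine Finset.sum_congr rfl fun i _ => ?_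
  have := (EuclideanSpace.proj i : Rn n →L[ℝ] ℝ).hasFDerivAt.comp x h.hasFDerivAt
  have h2 : fderiv ℝ (fun y => η y i) x = _ := this.fderiv
  rw [h2]; rfl

lemma sum_single_eq {n : ℕ} (v : Rn n) : v = ∑ i, v i • EuclideanSpace.single i (1:ℝ) := by
  ext j
  simp [Finset.sum_apply, Pi.single_apply]

lemma divN_continuous {n : ℕ} {η : Rn n → Rn n} (h : ContDiff ℝ 1 η) : Continuous (divN η) := by
  unfold divN
  have := h.continuous_fderiv (by norm_num)
  fun_prop

lemma divN_zero_of_notMem {n : ℕ} {η : Rn n → Rn n} {x : Rn n} (h : x ∉ tsupport η) :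
    divN η x = 0 := by
  unfold divN
  have : fderiv ℝ η x = 0 := by
    by_contra h2
    exact h (support_fderiv_subset ℝ h2)
  simp [this]

lemma divN_compact {n : ℕ} {η : Rn n → Rn n} (h : HasCompactSupport η) :
    HasCompactSupport (divN η) :=
  HasCompactSupport.intro' h (isClosed_tsupport _) fun _ hx => divN_zero_of_notMem hx

lemma divN_smul {n : ℕ} {η : Rn n → Rn n} {g : Rn n → ℝ} {x : Rn n}
    (h : DifferentiableAt ℝ η x) (hg : DifferentiableAt ℝ g x) :
    divN (fun y => g y • η y) x = g x * divN η x + fderiv ℝ g x (η x) := by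
  unfold divN
  have e : fderiv ℝ (fun y => g y • η y) x = _ := (hg.hasFDerivAt.smul h.hasFDerivAt).fderiv
  rw [e]
  conv_rhs => rw [sum_single_eq (η x)]
  simp [Finset.sum_add_distrib, Finset.mul_sum, mul_comm]

lemma divN_add {n : ℕ} {η ξ : Rn n → Rn n} {x : Rn n}
    (h : DifferentiableAt ℝ η x) (hg : DifferentiableAt ℝ ξ x) :
    divN (fun y => η y + ξ y) x = divN η x + divN ξ x := by
  unfold divN
  have e : fderiv ℝ (fun y => η y + ξ y) x = _ := (h.hasFDerivAt.add hg.hasFDerivAt).fderiv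
  rw [e]
  simp [Finset.sum_add_distrib]

lemma divN_neg {n : ℕ} {η : Rn n → Rn n} {x : Rn n} :
    divN (fun y => - η y) x = - divN η x := by
  unfold divN
  simp

lemma divN_comp_add {n : ℕ} (η : Rn n → Rn n) (a x : Rn n) :
    divN (fun y => η (y + a)) x = divN η (x + a) := by
  unfold divN
  rw [fderiv_comp_add_right]

lemma ibp {n : ℕ} {g : Rn n → ℝ} {η : Rn n → Rn n} (hg : ContDiff ℝ 1 g) (hη : ContDiff ℝ 1 η)
    (hc : HasCompactSupport η) :
    ∫ x, g x * divN η x = - ∫ x, fderiv ℝ g x (η x) := by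
  have hηi : ∀ i, ContDiff ℝ 1 (fun y => η y i) := fun i =>
    (EuclideanSpace.proj i : Rn n →L[ℝ] ℝ).contDiff.comp hη
  have hci : ∀ i, HasCompactSupport (fun y => η y i) := fun i =>
    hc.comp_left (g := fun v : Rn n => v i) rfl
  have hgf := hg.continuous_fderiv (by norm_num)
  have hgc := hg.continuous
  have e1 : ∀ x, g x * divN η x = ∑ i, g x * fderiv ℝ (fun y => η y i) x (EuclideanSpace.single i (1:ℝ)) := by
    intro x
    rw [divN_eq (hη.differentiable (by norm_num) x), Finset.mul_sum]
  have e2 : ∀ x, fderiv ℝ g x (η x) = ∑ i, fderiv ℝ g x (EuclideanSpace.single i (1:ℝ)) * η x i := by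
    intro x
    conv_lhs => rw [sum_single_eq (η x)]
    simp [mul_comm]
  have i1 : ∀ i, Integrable fun x => g x * fderiv ℝ (fun y => η y i) x (EuclideanSpace.single i (1:ℝ)) := by
    intro i
    have h1 := (hηi i).continuous_fderiv (by norm_num)
    apply Continuous.integrable_of_hasCompactSupport (by fun_prop)
    exact ((hci i).fderiv_apply ℝ (EuclideanSpace.single i (1:ℝ))).mul_left
  have i2 : ∀ i, Integrable fun x => fderiv ℝ g x (EuclideanSpace.single i (1:ℝ)) * η x i := by
    intro i
    have h1 := (hηi i).continuous
    apply Continuous.integrable_of_hasCompactSupport (by fun_prop)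
    exact (hci i).mul_left
  have i3 : ∀ i, Integrable fun x => g x * η x i := by
    intro i
    have h1 := (hηi i).continuous
    apply Continuous.integrable_of_hasCompactSupport (by fun_prop)
    exact (hci i).mul_left
  simp_rw [e1, e2]
  rw [integral_finsetSum _ (fun i _ => i1 i), integral_finsetSum _ (fun i _ => i2 i), ← Finset.sum_neg_distrib]
  refine Finset.sum_congr rfl fun i _ => ?_
  exact integral_mul_fderiv_eq_neg_fderiv_mul_of_integrable (i2 i) (i1 i) (i3 i)
    (fun x _ => hg.differentiable (by norm_num) x) (fun x _ => (hηi i).differentiable (by norm_num) x)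

lemma norm1_facts {n : ℕ} {Φ : Rn1 n → ℝ} (hΦ : IsNorm1 Φ) :
    ∃ c > (0:ℝ), ∃ l > (0:ℝ), (∀ p : Rn1 n, Φ p ≤ 1 → ‖p.1‖ ≤ c ∧ |p.2| ≤ c) ∧
      (∀ ξ : Rn n, ‖ξ‖ ≤ 1 → Φ (l • ξ, 0) ≤ 1) ∧
      (∀ (t : ℝ) (p q : Rn1 n), 0 ≤ t → t ≤ 1 → Φ p ≤ 1 → Φ q ≤ 1 → Φ ((1 - t) • p + t • q) ≤ 1) ∧
      Φ 0 ≤ 1 := by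
  obtain ⟨hconv, hhom, c, hc, hlow⟩ := hΦ
  have hcont : Continuous Φ := hconv.locallyLipschitz.continuous
  have h0 : Φ 0 = 0 := by simpa using hhom 0 0
  have key : ∀ p : Rn1 n, ‖p.1‖ ≤ enorm1 p ∧ |p.2| ≤ enorm1 p := by
    intro p
    have hd : dotp p p = ‖p.1‖^2 + p.2^2 := by
      rw [EuclideanSpace.norm_sq_eq]; simp [dotp, dotn, pow_two]
    unfold enorm1
    rw [hd]
    exact ⟨Real.le_sqrt_of_sq_le (by nlinarith [sq_nonneg p.2]), Real.le_sqrt_of_sq_le (by rw [sq_abs]; nlinarith [sq_nonneg ‖p.1‖])⟩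
  have hnear : ∀ᶠ p in nhds (0 : Rn1 n), Φ p < 1 := hcont.continuousAt.eventually_lt_const (by rw [h0]; norm_num)
  obtain ⟨δ, hδ, hb⟩ := Metric.eventually_nhds_iff.1 hnear
  refine ⟨c⁻¹, by positivity, δ/2, by positivity, ?_, ?_, ?_, by rw [h0]; norm_num⟩
  · intro p hp
    have h1 := hlow p
    have h2 : enorm1 p ≤ c⁻¹ := by
      rw [inv_eq_one_div, le_div_iff₀ hc]; linarith
    exact ⟨(key p).1.trans h2, (key p).2.trans h2⟩
  · intro ξ hξ
    refine (hb ?_).le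
    rw [dist_zero_right]
    simp only [Prod.norm_mk, norm_zero]
    rw [norm_smul, Real.norm_of_nonneg (by positivity)]
    rw [max_lt_iff]
    constructor <;> nlinarith [norm_nonneg ξ]
  · intro t p q ht0 ht1 hp hq
    have := hconv.2 (mem_univ p) (mem_univ q) (by linarith : 0 ≤ 1 - t) ht0 (by ring)
    refine this.trans ?_
    simp only [smul_eq_mul]
    nlinarith

def IsT {n : ℕ} (Φ : Rn1 n → ℝ) (A : Set (Rn n)) (η : Rn n → Rn1 n) : Prop :=
  ContDiff ℝ 1 η ∧ HasCompactSupport η ∧ tsupport η ⊆ A ∧ ∀ x, Φ (η x) ≤ 1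

structure NF {n : ℕ} (Φ : Rn1 n → ℝ) (c l : ℝ) : Prop where
  hc : 0 < c
  hl : 0 < l
  bd : ∀ p : Rn1 n, Φ p ≤ 1 → ‖p.1‖ ≤ c ∧ |p.2| ≤ c
  up : ∀ ξ : Rn n, ‖ξ‖ ≤ 1 → Φ (l • ξ, 0) ≤ 1
  conv : ∀ (t : ℝ) (p q : Rn1 n), 0 ≤ t → t ≤ 1 → Φ p ≤ 1 → Φ q ≤ 1 →
    Φ ((1 - t) • p + t • q) ≤ 1
  zero : Φ 0 ≤ 1

lemma fst_tsupport {n : ℕ} (η : Rn n → Rn1 n) : tsupport (fun y => (η y).1) ⊆ tsupport η := by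
  apply closure_mono
  intro x hx h
  apply hx
  simp [h]

lemma IsT.fst {n : ℕ} {Φ : Rn1 n → ℝ} {A : Set (Rn n)} {η : Rn n → Rn1 n} (h : IsT Φ A η) :
    ContDiff ℝ 1 (fun y => (η y).1) ∧ HasCompactSupport (fun y => (η y).1) :=
  ⟨contDiff_fst.comp h.1, h.2.1.comp_left (g := Prod.fst) rfl⟩

lemma IsT.snd {n : ℕ} {Φ : Rn1 n → ℝ} {A : Set (Rn n)} {η : Rn n → Rn1 n} (h : IsT Φ A η) :
    ContDiff ℝ 1 (fun y => (η y).2) ∧ HasCompactSupport (fun y => (η y).2) :=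
  ⟨contDiff_snd.comp h.1, h.2.1.comp_left (g := Prod.snd) rfl⟩

lemma smooth_ineq {n : ℕ} {Φ : Rn1 n → ℝ} {c l : ℝ} (hF : NF Φ c l) {A : Set (Rn n)}
    {U ζ : Rn n → ℝ} {γ : ℝ → ℝ} (hU : ContDiff ℝ 1 U) (hζ : ContDiff ℝ 1 ζ)
    (hζc : HasCompactSupport ζ) (hζA : tsupport ζ ⊆ A) (hζ0 : ∀ x, 0 ≤ ζ x) (hζ1 : ∀ x, ζ x ≤ 1)
    (hγ : ContDiff ℝ 2 γ) (hγ0 : ∀ t, 0 ≤ γ t) (hd0 : ∀ t, 0 ≤ deriv γ t) (hd1 : ∀ t, deriv γ t ≤ 1)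
    {η : Rn n → Rn1 n} (hη : IsT Φ A η) {ξ : Rn n → Rn n} (hξ : ContDiff ℝ 1 ξ)
    (hξc : HasCompactSupport ξ) (hξ1 : ∀ x, ‖ξ x‖ ≤ 1) {G : ℝ}
    (hG : ∀ θ, IsT Φ A θ → ∫ x, (U x * divN (fun y => (θ y).1) x + (θ x).2) ≤ G) :
    (∫ x, ((U x - ζ x * γ (U x)) * divN (fun y => (η y).1) x + (η x).2))
      + l * (∫ x, ζ x * γ (U x) * divN ξ x) ≤
    G + c * (∫ x, ζ x * deriv γ (U x)) + (c + l) * (∫ x, γ (U x) * ‖fderiv ℝ ζ x‖) := by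
  have hγ' : ContDiff ℝ 1 (deriv γ) := by
    have : ContDiff ℝ (1+1) γ := by simpa [one_add_one_eq_two] using hγ
    exact (contDiff_succ_iff_deriv.1 this).2.2
  have hγ1 : ContDiff ℝ 1 γ := hγ.of_le (by norm_num)
  set τ : Rn n → ℝ := fun x => ζ x * deriv γ (U x) with hτ
  have hτC : ContDiff ℝ 1 τ := hζ.mul (hγ'.comp hU)
  have hτc : HasCompactSupport τ := hζc.mul_right
  have hτ0 : ∀ x, 0 ≤ τ x := fun x => mul_nonneg (hζ0 x) (hd0 _)
  have hτ1 : ∀ x, τ x ≤ 1 := fun x => mul_le_one₀ (hζ1 x) (hd0 _) (hd1 _)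
  set θ : Rn n → Rn1 n := fun x => (1 - τ x) • η x + τ x • (l • ξ x, (0:ℝ)) with hθ
  have hθsupp : ∀ x, x ∉ tsupport η ∪ tsupport ζ → θ x = 0 := by
    intro x hx
    simp only [mem_union, not_or] at hx
    simp [hθ, hτ, image_eq_zero_of_notMem_tsupport hx.1, image_eq_zero_of_notMem_tsupport hx.2]
  have hcl : IsClosed (tsupport η ∪ tsupport ζ) := (isClosed_tsupport _).union (isClosed_tsupport _)
  have hθT : IsT Φ A θ := by
    refine ⟨?_, ?_, ?_, ?_⟩
    · exact ((contDiff_const.sub hτC).smul hη.1).add (hτC.smul ((hξ.const_smul l).prodMk contDiff_const))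
    · exact HasCompactSupport.intro' (hη.2.1.union hζc) hcl fun x hx => hθsupp x hx
    · refine (closure_minimal ?_ hcl).trans (union_subset hη.2.2.1 hζA)
      intro x hx
      by_contra h
      exact hx (hθsupp x h)
    · intro x
      exact hF.conv _ _ _ (hτ0 x) (hτ1 x) (hη.2.2.2 x) (hF.up _ (hξ1 x))
  have hGθ := hG θ hθT
  set W : Rn n → ℝ := fun x => ζ x * γ (U x) with hW
  have hWC : ContDiff ℝ 1 W := hζ.mul (hγ1.comp hU)
  have hWc : HasCompactSupport W := hζc.mul_right
  have hVC : ContDiff ℝ 1 (fun x => U x - W x) := hU.sub hWC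
  have fW : ∀ x v, fderiv ℝ W x v = τ x * fderiv ℝ U x v + γ (U x) * fderiv ℝ ζ x v := by
    intro x v
    have h1 : HasFDerivAt (fun x => γ (U x)) _ x :=
      ((hγ1.differentiable (by norm_num) (U x)).hasDerivAt).comp_hasFDerivAt x
        (hU.differentiable (by norm_num) x).hasFDerivAt
    have h2 := (hζ.differentiable (by norm_num) x).hasFDerivAt.mul h1
    have e : fderiv ℝ W x = _ := h2.fderiv
    rw [e]
    simp [hτ]
    ring
  have fV : ∀ x v, fderiv ℝ (fun x => U x - W x) x v = fderiv ℝ U x v - fderiv ℝ W x v := by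
    intro x v
    have e : fderiv ℝ (fun x => U x - W x) x = _ :=
      ((hU.differentiable (by norm_num) x).hasFDerivAt.sub (hWC.differentiable (by norm_num) x).hasFDerivAt).fderiv
    rw [e]; rfl
  have I1 := ibp hU hθT.fst.1 hθT.fst.2
  have I2 := ibp hVC hη.fst.1 hη.fst.2
  have I3 := ibp hWC hξ hξc
  -- integrability
  have cU := hU.continuous
  have cU' := hU.continuous_fderiv (by norm_num)
  have cζ := hζ.continuous
  have cζ' := hζ.continuous_fderiv (by norm_num)
  have cW := hWC.continuous
  have cW' := hWC.continuous_fderiv (by norm_num)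
  have cV' := hVC.continuous_fderiv (by norm_num)
  have cη1 := hη.fst.1.continuous
  have cθ1 := hθT.fst.1.continuous
  have cη2 := hη.snd.1.continuous
  have cθ2 := hθT.snd.1.continuous
  have cξ := hξ.continuous
  have cτ := hτC.continuous
  have cγ := hγ1.continuous
  have cdη := divN_continuous hη.fst.1
  have cdθ := divN_continuous hθT.fst.1
  have cdξ := divN_continuous hξ
  have app : ∀ (F : Rn n → (Rn n →L[ℝ] ℝ)) (v : Rn n → Rn n), Continuous F → Continuous v →
      HasCompactSupport v → Integrable (fun x => F x (v x)) := by
    intro F v h1 h2 h3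
    apply Continuous.integrable_of_hasCompactSupport (by fun_prop)
    exact HasCompactSupport.intro' h3 (isClosed_tsupport _) fun x hx => by
      simp [image_eq_zero_of_notMem_tsupport hx]
  have i1 := app _ _ cU' cθ1 hθT.fst.2
  have i2 := app _ _ cV' cη1 hη.fst.2
  have i3 := app _ _ cW' cξ hξc
  have j1 : Integrable (fun x => U x * divN (fun y => (θ y).1) x) :=
    Continuous.integrable_of_hasCompactSupport (by fun_prop) (divN_compact hθT.fst.2).mul_left
  have j2 : Integrable (fun x => (U x - W x) * divN (fun y => (η y).1) x) :=
    Continuous.integrable_of_hasCompactSupport (by fun_prop) (divN_compact hη.fst.2).mul_left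
  have k1 : Integrable (fun x => (θ x).2) := cθ2.integrable_of_hasCompactSupport hθT.snd.2
  have k2 : Integrable (fun x => (η x).2) := cη2.integrable_of_hasCompactSupport hη.snd.2
  have k3 : Integrable τ := cτ.integrable_of_hasCompactSupport hτc
  have k4 : Integrable (fun x => γ (U x) * ‖fderiv ℝ ζ x‖) :=
    Continuous.integrable_of_hasCompactSupport (by fun_prop) ((hζc.fderiv ℝ).norm.mul_left)
  have m1 : Integrable (fun x => -(fderiv ℝ (fun x => U x - W x) x (η x).1)) := i2.neg
  have m2 : Integrable (fun x => -(fderiv ℝ U x (θ x).1)) := i1.neg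
  have m3 : Integrable (fun x => -(fderiv ℝ (fun x => U x - W x) x (η x).1) + (η x).2) := m1.add k2
  have m4 : Integrable (fun x => -(fderiv ℝ U x (θ x).1) + (θ x).2) := m2.add k1
  have m5 : Integrable (fun x => c * τ x + (c + l) * (γ (U x) * ‖fderiv ℝ ζ x‖)) :=
    (k3.const_mul c).add (k4.const_mul (c+l))
  have key : ∫ x, ((-(fderiv ℝ (fun x => U x - W x) x (η x).1) + (η x).2) - l * fderiv ℝ W x (ξ x)) ≤
      ∫ x, ((-(fderiv ℝ U x (θ x).1) + (θ x).2) + (c * τ x + (c + l) * (γ (U x) * ‖fderiv ℝ ζ x‖))) := by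
    refine integral_mono (m3.sub (i3.const_mul l)) (m4.add m5) ?_
    intro x
    simp only [fV, fW]
    have e1 : fderiv ℝ U x (θ x).1 = (1 - τ x) * fderiv ℝ U x (η x).1 + τ x * (l * fderiv ℝ U x (ξ x)) := by
      simp [hθ]
    have e2 : (θ x).2 = (1 - τ x) * (η x).2 := by simp [hθ]
    rw [e1, e2]
    obtain ⟨b1, b2⟩ := hF.bd _ (hη.2.2.2 x)
    have b3 : τ x * (η x).2 ≤ c * τ x := by
      rw [mul_comm c]
      exact mul_le_mul_of_nonneg_left ((le_abs_self _).trans b2) (hτ0 x)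
    have b4 : fderiv ℝ ζ x (η x).1 ≤ c * ‖fderiv ℝ ζ x‖ := by
      refine (le_abs_self _).trans ?_
      have := (fderiv ℝ ζ x).le_opNorm (η x).1
      rw [Real.norm_eq_abs] at this
      nlinarith [norm_nonneg (fderiv ℝ ζ x)]
    have b5 : - fderiv ℝ ζ x (ξ x) ≤ ‖fderiv ℝ ζ x‖ := by
      refine (neg_le_abs _).trans ?_
      have := (fderiv ℝ ζ x).le_opNorm (ξ x)
      rw [Real.norm_eq_abs] at this
      nlinarith [norm_nonneg (fderiv ℝ ζ x), hξ1 x]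
    have b6 := mul_le_mul_of_nonneg_left b4 (hγ0 (U x))
    have b7 := mul_le_mul_of_nonneg_left b5 (mul_nonneg hF.hl.le (hγ0 (U x)))
    nlinarith
  rw [integral_sub m3 (i3.const_mul l), integral_add m1 k2, integral_neg,
    integral_add m4 m5, integral_add m2 k1, integral_neg,
    integral_add (k3.const_mul c) (k4.const_mul (c+l)),
    integral_const_mul, integral_const_mul, integral_const_mul] at key
  rw [integral_add j1 k1, I1] at hGθ
  change (∫ x, ((U x - W x) * divN (fun y => (η y).1) x + (η x).2))
      + l * (∫ x, W x * divN ξ x) ≤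
    G + c * (∫ x, τ x) + (c + l) * (∫ x, γ (U x) * ‖fderiv ℝ ζ x‖)
  rw [integral_add j2 k2, I2, I3]
  linarith

noncomputable def bmp {n : ℕ} (ε : ℝ) (h : 0 < ε) : ContDiffBump (0 : Rn n) where
  rIn := ε / 2
  rOut := ε
  rIn_pos := by positivity
  rIn_lt_rOut := by linarith

noncomputable def mol {n : ℕ} (ε : ℝ) (h : 0 < ε) (g : Rn n → ℝ) : Rn n → ℝ :=
  ((bmp ε h).normed volume) ⋆[ContinuousLinearMap.lsmul ℝ ℝ, volume] g

lemma mol_apply {n : ℕ} (ε : ℝ) (h : 0 < ε) (g : Rn n → ℝ) (x : Rn n) :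
    mol ε h g x = ∫ t, (bmp ε h).normed volume t * g (x - t) := by
  simp [mol, convolution_def]

lemma mol_contDiff {n : ℕ} (ε : ℝ) (h : 0 < ε) {g : Rn n → ℝ} (hg : LocallyIntegrable g) :
    ContDiff ℝ 1 (mol ε h g) := by
  have := (bmp ε h).hasCompactSupport_normed.contDiff_convolution_left (n := 1)
    (ContinuousLinearMap.lsmul ℝ ℝ) ((bmp (n := n) ε h).contDiff_normed (μ := volume)) hg
  exact_mod_cast this

lemma mol_ae {n : ℕ} {ε : ℕ → ℝ} (h : ∀ k, 0 < ε k) (hε : Tendsto ε atTop (𝓝 0))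
    {g : Rn n → ℝ} (hg : LocallyIntegrable g) :
    ∀ᵐ x, Tendsto (fun k => mol (ε k) (h k) g x) atTop (𝓝 (g x)) := by
  refine ContDiffBump.ae_convolution_tendsto_right_of_locallyIntegrable (K := 2)
    (φ := fun k => bmp (ε k) (h k)) hε ?_ hg
  refine Eventually.of_forall fun k => ?_
  simp only [bmp]; linarith

lemma mol_fubini {n : ℕ} (ε : ℝ) (h : 0 < ε) {g D : Rn n → ℝ} (hg : Integrable g)
    (hD : Continuous D) (hDc : HasCompactSupport D) :
    ∫ x, mol ε h g x * D x = ∫ t, (bmp ε h).normed volume t * ∫ x, g (x - t) * D x := by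
  obtain ⟨C, hC⟩ := hDc.exists_bound_of_continuous hD
  have hφ : Integrable ((bmp (n := n) ε h).normed volume) := (bmp ε h).integrable_normed
  have h1 : Integrable (fun p : Rn n × Rn n =>
      (bmp ε h).normed volume p.2 * g (p.1 - p.2)) (volume.prod volume) :=
    hφ.convolution_integrand (ContinuousLinearMap.lsmul ℝ ℝ) hg
  have h2 : Integrable (fun p : Rn n × Rn n =>
      ((bmp ε h).normed volume p.2 * g (p.1 - p.2)) * D p.1) (volume.prod volume) := by
    refine h1.mul_bdd (c := C) ?_ ?_
    · exact (hD.comp continuous_fst).aestronglyMeasurable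
    · exact Eventually.of_forall fun p => hC p.1
  calc ∫ x, mol ε h g x * D x
      = ∫ x, ∫ t, ((bmp ε h).normed volume t * g (x - t)) * D x := by
        congr 1; ext x; rw [mol_apply, integral_mul_const]
    _ = ∫ t, ∫ x, ((bmp ε h).normed volume t * g (x - t)) * D x :=
        integral_integral_swap h2
    _ = _ := by
        congr 1; ext t; simp_rw [mul_assoc]; rw [integral_const_mul]

lemma shift_cont {n : ℕ} {g D : Rn n → ℝ} (hg : Integrable g)
    (hD : Continuous D) (hDc : HasCompactSupport D) :
    Continuous (fun s : Rn n => ∫ x, g (x + s) * D x) := by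
  obtain ⟨C, hC⟩ := hDc.exists_bound_of_continuous hD
  have : (fun s : Rn n => ∫ x, g (x + s) * D x) = fun s => ∫ x, g x * D (x - s) := by
    ext s
    rw [← integral_add_right_eq_self (fun x => g x * D (x - s)) s]
    simp
  rw [this]
  refine continuous_of_dominated (bound := fun x => ‖g x‖ * C) ?_ ?_ (hg.norm.mul_const C) ?_
  · intro s
    exact hg.aestronglyMeasurable.mul (by fun_prop : Continuous fun x => D (x - s)).aestronglyMeasurable
  · intro s
    refine Eventually.of_forall fun x => ?_
    rw [norm_mul]
    exact mul_le_mul_of_nonneg_left (hC _) (norm_nonneg _)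
  · exact Eventually.of_forall fun x => by fun_prop

lemma mol_tendsto {n : ℕ} {ε : ℕ → ℝ} (h : ∀ k, 0 < ε k) (hε : Tendsto ε atTop (𝓝 0))
    {g D : Rn n → ℝ} (hg : Integrable g) (hD : Continuous D) (hDc : HasCompactSupport D) :
    Tendsto (fun k => ∫ x, mol (ε k) (h k) g x * D x) atTop (𝓝 (∫ x, g x * D x)) := by
  have := ContDiffBump.convolution_tendsto_right_of_continuous (μ := (volume : Measure (Rn n)))
    (φ := fun k => bmp (ε k) (h k)) hε (shift_cont hg hD hDc) 0
  simp only [add_zero] at this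
  refine this.congr fun k => ?_
  rw [mol_fubini _ _ hg hD hDc, convolution_def]
  simp [sub_eq_add_neg]

lemma mol_le {n : ℕ} (ε : ℝ) (h : 0 < ε) {g D s : Rn n → ℝ} (hg : Integrable g)
    (hD : Continuous D) (hDc : HasCompactSupport D) (hs : Integrable s) {G : ℝ}
    (hG : ∀ y : Rn n, ‖y‖ < ε → ∫ x, (g (x - y) * D x + s x) ≤ G) :
    ∫ x, (mol ε h g x * D x + s x) ≤ G := by
  have hmc : Continuous (mol ε h g) := (mol_contDiff ε h hg.locallyIntegrable).continuous
  have i1 : Integrable (fun x => mol ε h g x * D x) :=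
    Continuous.integrable_of_hasCompactSupport (by fun_prop) hDc.mul_left
  rw [integral_add i1 hs, mol_fubini _ _ hg hD hDc]
  have hφ : Integrable ((bmp (n := n) ε h).normed volume) := (bmp ε h).integrable_normed
  have hφ1 : ∫ t, (bmp (n := n) ε h).normed volume t = 1 := (bmp ε h).integral_normed
  have hF : Continuous (fun t : Rn n => ∫ x, g (x - t) * D x) := by
    have := (shift_cont hg hD hDc).comp (continuous_neg)
    simpa [Function.comp_def, sub_eq_add_neg] using this
  have hint : Integrable (fun t => (bmp ε h).normed volume t * ∫ x, g (x - t) * D x) :=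
    Continuous.integrable_of_hasCompactSupport
      (((bmp ε h).contDiff_normed (n := 1)).continuous.mul hF) ((bmp ε h).hasCompactSupport_normed.mul_right)
  have e : (∫ t, (bmp ε h).normed volume t * ∫ x, g (x - t) * D x) ≤
      ∫ t, (bmp (n := n) ε h).normed volume t * (G - ∫ x, s x) := by
    refine integral_mono hint (hφ.mul_const _) fun t => ?_
    by_cases ht : t ∈ Metric.ball (0 : Rn n) ε
    · refine mul_le_mul_of_nonneg_left ?_ ((bmp ε h).nonneg_normed t)
      have := hG t (by simpa using ht)
      obtain ⟨C, hC⟩ := hDc.exists_bound_of_continuous hD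
      rw [integral_add _ hs] at this
      · linarith
      · exact (hg.comp_sub_right t).mul_bdd (c := C) hD.aestronglyMeasurable (Eventually.of_forall hC)
    · have : (bmp (n := n) ε h).normed volume t = 0 := by
        rw [← Function.notMem_support, (bmp ε h).support_normed_eq]
        exact ht
      simp [this]
  rw [integral_mul_const, hφ1] at e
  linarith

lemma int_split {n : ℕ} {a b s : Rn n → ℝ} (ha : Integrable a) (hb : Integrable b)
    (hs : Integrable s) : (∫ x, a x) - (∫ x, b x) + (∫ x, s x) = ∫ x, (a x - b x + s x) := by
  have h : Integrable (fun x => a x - b x) := ha.sub hb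
  rw [integral_add h hs, integral_sub ha hb]

lemma limit_ineq {n : ℕ} {Φ : Rn1 n → ℝ} {c l : ℝ} (hF : NF Φ c l) {A : Set (Rn n)}
    {g ζ : Rn n → ℝ} {γ : ℝ → ℝ} (hg : Integrable g) (hζ : ContDiff ℝ 1 ζ)
    (hζc : HasCompactSupport ζ) (hζA : tsupport ζ ⊆ A) (hζ0 : ∀ x, 0 ≤ ζ x) (hζ1 : ∀ x, ζ x ≤ 1)
    (hγ : ContDiff ℝ 2 γ) (hγ0 : ∀ t, 0 ≤ γ t) (hd0 : ∀ t, 0 ≤ deriv γ t) (hd1 : ∀ t, deriv γ t ≤ 1)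
    {M : ℝ} (hγM : ∀ t, γ t ≤ M)
    {ε : ℕ → ℝ} (h : ∀ k, 0 < ε k) (hε : Tendsto ε atTop (𝓝 0)) {Gk : ℕ → ℝ} {G : ℝ}
    (hGk : Tendsto Gk atTop (𝓝 G))
    (hG : ∀ k, ∀ θ, IsT Φ A θ → ∀ y : Rn n, ‖y‖ < ε k →
      ∫ x, (g (x - y) * divN (fun y => (θ y).1) x + (θ x).2) ≤ Gk k)
    {η : Rn n → Rn1 n} (hη : IsT Φ A η) {ξ : Rn n → Rn n} (hξ : ContDiff ℝ 1 ξ)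
    (hξc : HasCompactSupport ξ) (hξ1 : ∀ x, ‖ξ x‖ ≤ 1) :
    (∫ x, ((g x - ζ x * γ (g x)) * divN (fun y => (η y).1) x + (η x).2))
      + l * (∫ x, ζ x * γ (g x) * divN ξ x) ≤
    G + c * (∫ x, ζ x * deriv γ (g x)) + (c + l) * (∫ x, γ (g x) * ‖fderiv ℝ ζ x‖) := by
  have hγ' : Continuous (deriv γ) := hγ.continuous_deriv (by norm_num)
  have hγc : Continuous γ := hγ.continuous
  have cζ := hζ.continuous
  have cζ' := hζ.continuous_fderiv (by norm_num)
  have cdη := divN_continuous hη.fst.1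
  have cdξ := divN_continuous hξ
  have hae := mol_ae h hε hg.locallyIntegrable
  have hmc : ∀ k, Continuous (mol (ε k) (h k) g) := fun k =>
    (mol_contDiff _ _ hg.locallyIntegrable).continuous
  -- generic dominated convergence
  have dct : ∀ (κ : ℝ → ℝ) (w : Rn n → ℝ) (N : ℝ), Continuous κ → (∀ t, |κ t| ≤ N) → Integrable w →
      Tendsto (fun k => ∫ x, κ (mol (ε k) (h k) g x) * w x) atTop (𝓝 (∫ x, κ (g x) * w x)) := by
    intro κ w N hκ hN hw
    refine tendsto_integral_of_dominated_convergence (fun x => N * ‖w x‖) ?_ (hw.norm.const_mul N) ?_ ?_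
    · intro k
      exact (hκ.comp (hmc k)).aestronglyMeasurable.mul hw.aestronglyMeasurable
    · intro k
      refine Eventually.of_forall fun x => ?_
      rw [norm_mul]
      exact mul_le_mul_of_nonneg_right (hN _) (norm_nonneg _)
    · filter_upwards [hae] with x hx
      exact ((hκ.tendsto _).comp hx).mul_const _
  have hγabs : ∀ t, |γ t| ≤ M := fun t => by rw [abs_of_nonneg (hγ0 t)]; exact hγM t
  have hdabs : ∀ t, |deriv γ t| ≤ 1 := fun t => by rw [abs_of_nonneg (hd0 t)]; exact hd1 t
  have w1 : Integrable (fun x => ζ x * divN (fun y => (η y).1) x) :=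
    Continuous.integrable_of_hasCompactSupport (by fun_prop) hζc.mul_right
  have w2 : Integrable (fun x => ζ x * divN ξ x) :=
    Continuous.integrable_of_hasCompactSupport (by fun_prop) hζc.mul_right
  have w3 : Integrable ζ := cζ.integrable_of_hasCompactSupport hζc
  have w4 : Integrable (fun x => ‖fderiv ℝ ζ x‖) :=
    Continuous.integrable_of_hasCompactSupport (by fun_prop) (hζc.fderiv ℝ).norm
  have k2 : Integrable (fun x => (η x).2) :=
    hη.snd.1.continuous.integrable_of_hasCompactSupport hη.snd.2
  have t0 := mol_tendsto h hε hg cdη (divN_compact hη.fst.2)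
  have t1 := dct γ _ M hγc hγabs w1
  have t2 := dct γ _ M hγc hγabs w2
  have t3 := dct _ _ 1 hγ' hdabs w3
  have t4 := dct γ _ M hγc hγabs w4
  have ineq : ∀ k, ((∫ x, mol (ε k) (h k) g x * divN (fun y => (η y).1) x)
      - (∫ x, γ (mol (ε k) (h k) g x) * (ζ x * divN (fun y => (η y).1) x)) + (∫ x, (η x).2))
      + l * (∫ x, γ (mol (ε k) (h k) g x) * (ζ x * divN ξ x)) ≤
      Gk k + c * (∫ x, deriv γ (mol (ε k) (h k) g x) * ζ x)
       + (c + l) * (∫ x, γ (mol (ε k) (h k) g x) * ‖fderiv ℝ ζ x‖) := by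
    intro k
    have hmk := hmc k
    have := smooth_ineq hF (mol_contDiff (ε k) (h k) hg.locallyIntegrable) hζ hζc hζA hζ0 hζ1 hγ hγ0
      hd0 hd1 hη hξ hξc hξ1 (G := Gk k) (fun θ hθ => mol_le _ _ hg (divN_continuous hθ.fst.1)
        (divN_compact hθ.fst.2) (hθ.snd.1.continuous.integrable_of_hasCompactSupport hθ.snd.2)
        (hG k θ hθ))
    have a1 : Integrable (fun x => mol (ε k) (h k) g x * divN (fun y => (η y).1) x) :=
      Continuous.integrable_of_hasCompactSupport (by fun_prop) (divN_compact hη.fst.2).mul_left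
    have a2 : Integrable (fun x => γ (mol (ε k) (h k) g x) * (ζ x * divN (fun y => (η y).1) x)) :=
      Continuous.integrable_of_hasCompactSupport (by fun_prop) hζc.mul_right.mul_left
    rw [int_split a1 a2 k2]
    convert this using 3
    · congr 1; ext x; ring
    · congr 1; ext x; ring
    · congr 1; congr 1; ext x; ring
  have lim := le_of_tendsto_of_tendsto' (((t0.sub t1).add_const (∫ x, (η x).2)).add (t2.const_mul l))
    ((hGk.add (t3.const_mul c)).add (t4.const_mul (c + l))) ineq
  have b1 : Integrable (fun x => g x * divN (fun y => (η y).1) x) := by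
    obtain ⟨C, hC⟩ := (divN_compact hη.fst.2).exists_bound_of_continuous cdη
    exact hg.mul_bdd (c := C) cdη.aestronglyMeasurable (Eventually.of_forall hC)
  have b2 : Integrable (fun x => γ (g x) * (ζ x * divN (fun y => (η y).1) x)) :=
    w1.bdd_mul (c := M) (hγc.comp_aestronglyMeasurable hg.aestronglyMeasurable)
      (Eventually.of_forall fun x => hγabs _)
  rw [int_split b1 b2 k2] at lim
  have q1 : ∀ x, (g x - ζ x * γ (g x)) * divN (fun y => (η y).1) x + (η x).2 =
    g x * divN (fun y => (η y).1) x - γ (g x) * (ζ x * divN (fun y => (η y).1) x) + (η x).2 :=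
    fun x => by ring
  have q2 : ∀ x, ζ x * γ (g x) * divN ξ x = γ (g x) * (ζ x * divN ξ x) := fun x => by ring
  have q3 : ∀ x, ζ x * deriv γ (g x) = deriv γ (g x) * ζ x := fun x => by ring
  simp_rw [q1, q2, q3]
  exact lim

def TVb {n : ℕ} (f : Rn n → ℝ) (T : ℝ) : Prop :=
  ∀ ξ : Rn n → Rn n, ContDiff ℝ 1 ξ → HasCompactSupport ξ → (∀ x, ‖ξ x‖ ≤ 1) →
    ∫ x, f x * divN ξ x ≤ T

lemma TVb.scaled {n : ℕ} {f : Rn n → ℝ} {T : ℝ} (hT : TVb f T) {K : ℝ} (hK : 0 < K)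
    {ξ : Rn n → Rn n} (h1 : ContDiff ℝ 1 ξ) (h2 : HasCompactSupport ξ) (h3 : ∀ x, ‖ξ x‖ ≤ K) :
    |∫ x, f x * divN ξ x| ≤ K * T := by
  have key : ∀ a : ℝ, |a| = 1 → a * (∫ x, f x * divN ξ x) ≤ K * T := by
    intro a ha
    have := hT (fun x => (a * K⁻¹) • ξ x) (h1.const_smul _) (h2.smul_left (f := fun _ => a * K⁻¹)) (by
      intro x
      rw [norm_smul, norm_mul, norm_inv, Real.norm_eq_abs, Real.norm_eq_abs, ha, abs_of_pos hK, one_mul]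
      rw [inv_mul_le_iff₀ hK]; simpa using h3 x)
    have e : ∀ x, f x * divN (fun x => (a * K⁻¹) • ξ x) x = (a * K⁻¹) * (f x * divN ξ x) := by
      intro x
      rw [divN_smul (g := fun _ => a * K⁻¹) (h1.differentiable (by norm_num) x) (by fun_prop)]
      simp; ring
    simp_rw [e] at this
    rw [integral_const_mul] at this
    have h5 := mul_le_mul_of_nonneg_left this hK.le
    have : K * (a * K⁻¹ * ∫ x, f x * divN ξ x) = a * ∫ x, f x * divN ξ x := by
      field_simp
    linarith
  rw [abs_le]
  constructor
  · have := key (-1) (by norm_num); linarith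
  · have := key 1 (by norm_num); linarith

lemma trans_dual {n : ℕ} {f : Rn n → ℝ} {T : ℝ} (hf : Integrable f) (hT : TVb f T)
    {φ : Rn n → ℝ} (hφ : ContDiff ℝ 1 φ) (hφc : HasCompactSupport φ) (hφ1 : ∀ x, |φ x| ≤ 1) (y : Rn n) :
    |(∫ x, f x * φ (x - y)) - ∫ x, f x * φ x| ≤ ‖y‖ * T := by
  by_cases hy : y = 0
  · subst hy; simp
  have hK : 0 < ‖y‖ := norm_pos_iff.2 hy
  have cφ := hφ.continuous
  have cφ' := hφ.continuous_fderiv (by norm_num)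
  obtain ⟨C, hC⟩ := (hφc.fderiv ℝ).exists_bound_of_continuous cφ'
  set D : ℝ → ℝ := fun t => ∫ x, f x * φ (x - t • y) with hD
  set D' : ℝ → ℝ := fun t => ∫ x, f x * (-(fderiv ℝ φ (x - t • y) y)) with hD'
  have hder : ∀ t, HasDerivAt D (D' t) t := by
    intro t
    refine (hasDerivAt_integral_of_dominated_loc_of_deriv_le (𝕜 := ℝ) (μ := volume) (x₀ := t)
      (F := fun s x => f x * φ (x - s • y)) (F' := fun s x => f x * (-(fderiv ℝ φ (x - s • y) y)))
      (s := univ) (bound := fun x => ‖f x‖ * (C * ‖y‖))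
      univ_mem ?_ ?_ ?_ ?_ ?_ ?_).2
    · exact Eventually.of_forall fun s => hf.aestronglyMeasurable.mul
        (by fun_prop : Continuous fun x => φ (x - s • y)).aestronglyMeasurable
    · exact hf.mul_bdd (c := 1) (by fun_prop : Continuous fun x => φ (x - t • y)).aestronglyMeasurable
        (Eventually.of_forall fun x => hφ1 _)
    · exact hf.aestronglyMeasurable.mul
        (by fun_prop : Continuous fun x => -(fderiv ℝ φ (x - t • y) y)).aestronglyMeasurable
    · refine Eventually.of_forall fun x s _ => ?_
      rw [norm_mul, norm_neg]
      refine mul_le_mul_of_nonneg_left ?_ (norm_nonneg _)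
      exact (ContinuousLinearMap.le_opNorm _ _).trans (mul_le_mul_of_nonneg_right (hC _) (norm_nonneg _))
    · exact hf.norm.mul_const _
    · refine Eventually.of_forall fun x s _ => ?_
      have h1 : HasDerivAt (fun s : ℝ => x - s • y) (-y) s := by
        simpa using ((hasDerivAt_id s).smul_const y).const_sub x
      have h2 := (hφ.differentiable (by norm_num) (x - s • y)).hasFDerivAt.comp_hasDerivAt s h1
      have := h2.const_mul (f x)
      simpa using this
  have hbd : ∀ t, ‖D' t‖ ≤ ‖y‖ * T := by
    intro t
    have hs : ContDiff ℝ 1 (fun x => φ (x - t • y)) := hφ.comp (contDiff_id.sub contDiff_const)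
    have hsc : HasCompactSupport (fun x => φ (x - t • y)) :=
      hφc.comp_homeomorph (Homeomorph.subRight (t • y))
    have h1 := hT.scaled hK (ξ := fun x => φ (x - t • y) • y) (hs.smul contDiff_const)
      (hsc.smul_right (f' := fun _ => y)) (by
        intro x
        rw [norm_smul]
        exact mul_le_of_le_one_left hK.le (hφ1 _))
    have e : ∀ x, divN (fun x => φ (x - t • y) • y) x = fderiv ℝ φ (x - t • y) y := by
      intro x
      rw [divN_smul (η := fun _ => y) (by fun_prop) (hs.differentiable (by norm_num) x)]
      rw [fderiv_comp_sub]
      simp [divN]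
    simp_rw [e] at h1
    have : D' t = - ∫ x, f x * fderiv ℝ φ (x - t • y) y := by
      rw [hD', ← integral_neg]; simp
    rw [this, norm_neg]
    exact h1
  have := norm_image_sub_le_of_norm_deriv_le_segment_01' (f := D) (f' := D') (C := ‖y‖ * T)
    (fun t _ => (hder t).hasDerivWithinAt) (fun t _ => hbd t)
  simpa [hD] using this

lemma mol_bound {n : ℕ} (ε : ℝ) (h : 0 < ε) {s : Rn n → ℝ} (hs : ∀ x, |s x| ≤ 1) (x : Rn n) :
    |mol ε h s x| ≤ 1 := by
  rw [mol_apply]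
  have hφ1 : ∫ t, (bmp (n := n) ε h).normed volume t = 1 := (bmp ε h).integral_normed
  rw [← hφ1, ← Real.norm_eq_abs]
  have hi : Integrable ((bmp (n := n) ε h).normed volume) := (bmp ε h).integrable_normed
  refine norm_integral_le_of_norm_le hi (Eventually.of_forall fun t => ?_)
  rw [norm_mul, Real.norm_of_nonneg ((bmp ε h).nonneg_normed t)]
  exact mul_le_of_le_one_right ((bmp ε h).nonneg_normed t) (hs _)

lemma l1_dual {n : ℕ} {g : Rn n → ℝ} {K : ℝ} (hg : Integrable g) (hgm : Measurable g)
    (hK : ∀ φ : Rn n → ℝ, ContDiff ℝ 1 φ → HasCompactSupport φ → (∀ x, |φ x| ≤ 1) →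
      ∫ x, g x * φ x ≤ K) : ∫ x, |g x| ≤ K := by
  have main : ∀ N : ℕ, ∫ x in Metric.ball (0 : Rn n) N, |g x| ≤ K := by
    intro N
    set s : Rn n → ℝ := (Metric.ball (0 : Rn n) N).indicator (fun x => if 0 ≤ g x then 1 else -1) with hs
    have hsm : Measurable s := by
      refine Measurable.indicator ?_ measurableSet_ball
      exact Measurable.ite (measurableSet_le measurable_const hgm) measurable_const measurable_const
    have hs1 : ∀ x, |s x| ≤ 1 := by
      intro x
      simp only [hs, indicator]
      split_ifs <;> simp
    have hsc : HasCompactSupport s := by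
      refine HasCompactSupport.intro (isCompact_closedBall (0 : Rn n) N) fun x hx => ?_
      exact indicator_of_notMem (fun h => hx (Metric.ball_subset_closedBall h)) _
    have hsi : Integrable s := by
      have : IntegrableOn (fun x => if 0 ≤ g x then (1:ℝ) else -1) (Metric.ball (0 : Rn n) N) := by
        refine Measure.integrableOn_of_bounded (M := 1) measure_ball_lt_top.ne ?_ ?_
        · exact (Measurable.ite (measurableSet_le measurable_const hgm) measurable_const measurable_const).aestronglyMeasurable
        · exact Eventually.of_forall fun x => by split_ifs <;> simp
      exact this.integrable_indicator measurableSet_ball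
    have hpos : ∀ k : ℕ, (0:ℝ) < 1 / ((k:ℝ) + 1) := fun k => by positivity
    have hlim := tendsto_one_div_add_atTop_nhds_zero_nat (𝕜 := ℝ)
    have hae := mol_ae hpos hlim hsi.locallyIntegrable
    have t : Tendsto (fun k : ℕ => ∫ x, g x * mol _ (hpos k) s x) atTop (𝓝 (∫ x, g x * s x)) := by
      refine tendsto_integral_of_dominated_convergence (fun x => ‖g x‖) ?_ hg.norm ?_ ?_
      · intro k
        exact hg.aestronglyMeasurable.mul (mol_contDiff _ _ hsi.locallyIntegrable).continuous.aestronglyMeasurable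
      · intro k
        refine Eventually.of_forall fun x => ?_
        rw [norm_mul]
        exact mul_le_of_le_one_right (norm_nonneg _) (mol_bound _ _ hs1 x)
      · filter_upwards [hae] with x hx
        exact hx.const_mul _
    have h1 : ∫ x, g x * s x ≤ K := by
      refine le_of_tendsto' t fun k => hK _ (mol_contDiff _ _ hsi.locallyIntegrable) ?_ (mol_bound _ _ hs1)
      exact HasCompactSupport.convolution _ (bmp _ _).hasCompactSupport_normed hsc
    rw [← integral_indicator measurableSet_ball]
    convert h1 using 2
    ext x
    simp only [hs, indicator]
    split_ifs with h1 h2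
    · rw [abs_of_nonneg h2, mul_one]
    · rw [abs_of_neg (not_le.1 h2)]; ring
    · simp
  have hc : AECover (volume : Measure (Rn n)) atTop (fun N : ℕ => Metric.ball (0 : Rn n) N) :=
    aecover_ball tendsto_natCast_atTop_atTop
  exact le_of_tendsto' (hc.integral_tendsto_of_countably_generated hg.abs) main

lemma trans_l1 {n : ℕ} {f : Rn n → ℝ} {T : ℝ} (hf : Integrable f) (hfm : Measurable f) (hT : TVb f T)
    (y : Rn n) : ∫ x, |f x - f (x + y)| ≤ ‖y‖ * T := by
  have hf2 : Integrable (fun x => f (x + y)) := hf.comp_add_right y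
  refine l1_dual (hf.sub hf2) (hfm.sub (by fun_prop)) fun φ h1 h2 h3 => ?_
  have h4 := trans_dual hf hT h1 h2 h3 y
  have i1 : Integrable (fun x => f x * φ x) :=
    hf.mul_bdd (c := 1) h1.continuous.aestronglyMeasurable (Eventually.of_forall h3)
  have i2 : Integrable (fun x => f (x + y) * φ x) :=
    hf2.mul_bdd (c := 1) h1.continuous.aestronglyMeasurable (Eventually.of_forall h3)
  have e : ∫ x, (f x - f (x + y)) * φ x = (∫ x, f x * φ x) - ∫ x, f (x + y) * φ x := by
    rw [← integral_sub i1 i2]; simp_rw [sub_mul]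
  have e2 : ∫ x, f (x + y) * φ x = ∫ x, f x * φ (x - y) := by
    rw [← integral_add_right_eq_self (fun x => f x * φ (x - y)) y]; simp
  change ∫ x, (f x - f (x + y)) * φ x ≤ _
  rw [e, e2]
  rw [abs_sub_comm] at h4
  exact (le_abs_self _).trans h4

lemma poincare {n : ℕ} {f : Rn n → ℝ} {T : ℝ} (hf : Integrable f) (hfm : Measurable f) (hT : TVb f T)
    (hT0 : 0 ≤ T) {ρ : ℝ} (hρ : 0 < ρ)
    (hvol : 2 * volume {x | f x ≠ 0} ≤ volume (Metric.ball (0 : Rn n) ρ)) :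
    ∫ x, |f x| ≤ 2 * ρ * T := by
  set B := Metric.ball (0 : Rn n) ρ with hB
  have hBfin : volume B ≠ ⊤ := measure_ball_lt_top.ne
  have hBpos : volume B ≠ 0 := (Metric.measure_ball_pos volume _ hρ).ne'
  have hfs : MeasurableSet {x | f x ≠ 0} := (hfm (measurableSet_singleton 0)).compl
  have up : ∫⁻ y in B, ∫⁻ x, ‖f x - f (x + y)‖ₑ ≤ volume B * ENNReal.ofReal (ρ * T) := by
    calc ∫⁻ y in B, ∫⁻ x, ‖f x - f (x + y)‖ₑ ≤ ∫⁻ y in B, ENNReal.ofReal (ρ * T) := by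
          refine setLIntegral_mono measurable_const fun y hy => ?_
          have hi : Integrable (fun x => f x - f (x + y)) := hf.sub (hf.comp_add_right y)
          rw [← ofReal_integral_norm_eq_lintegral_enorm hi]
          refine ENNReal.ofReal_le_ofReal ((trans_l1 hf hfm hT y).trans ?_)
          have : ‖y‖ < ρ := by simpa [hB] using hy
          gcongr
      _ = _ := by rw [setLIntegral_const, mul_comm]
  have low : ∀ x, ‖f x‖ₑ * (volume B / 2) ≤ ∫⁻ y in B, ‖f x - f (x + y)‖ₑ := by
    intro x
    set N := {y | f (x + y) ≠ 0} with hN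
    have hNm : MeasurableSet N := by
      have : Measurable (fun y => f (x + y)) := by fun_prop
      exact (this (measurableSet_singleton 0)).compl
    have hNv : volume N = volume {x | f x ≠ 0} := by
      have : N = (fun y => x + y) ⁻¹' {x | f x ≠ 0} := rfl
      rw [this, measure_preimage_add]
    have hN2 : volume N ≤ volume B / 2 := by
      rw [ENNReal.le_div_iff_mul_le (by simp) (by simp), mul_comm, hNv]; exact hvol
    have h2 : volume B / 2 ≤ volume (B \ N) := by
      have h3 : volume B - volume N ≤ volume (B \ N) := le_measure_sdiff
      refine le_trans ?_ h3
      calc volume B / 2 = volume B - volume B / 2 := (ENNReal.sub_half hBfin).symm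
        _ ≤ _ := tsub_le_tsub_left hN2 _
    calc ‖f x‖ₑ * (volume B / 2) ≤ ‖f x‖ₑ * volume (B \ N) := by gcongr
      _ = ∫⁻ y in B \ N, ‖f x‖ₑ := by rw [setLIntegral_const]
      _ = ∫⁻ y in B \ N, ‖f x - f (x + y)‖ₑ := by
          refine setLIntegral_congr_fun (measurableSet_ball.diff hNm) fun y hy => ?_
          have : f (x + y) = 0 := by simpa [hN] using hy.2
          simp [this]
      _ ≤ _ := lintegral_mono_set sdiff_subset
  have sw : ∫⁻ y in B, ∫⁻ x, ‖f x - f (x + y)‖ₑ = ∫⁻ x, ∫⁻ y in B, ‖f x - f (x + y)‖ₑ := by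
    refine lintegral_lintegral_swap ?_
    refine Measurable.aemeasurable ?_
    unfold Function.uncurry
    fun_prop
  have tot : (∫⁻ x, ‖f x‖ₑ) * (volume B / 2) ≤ volume B * ENNReal.ofReal (ρ * T) := by
    rw [← lintegral_mul_const _ (by fun_prop)]
    exact (lintegral_mono low).trans (sw ▸ up)
  rw [← ofReal_integral_norm_eq_lintegral_enorm hf] at tot
  have tr := ENNReal.toReal_mono (ENNReal.mul_ne_top hBfin ENNReal.ofReal_ne_top) tot
  have hb : 0 < (volume B).toReal := ENNReal.toReal_pos hBpos hBfin
  rw [ENNReal.toReal_mul, ENNReal.toReal_mul, ENNReal.toReal_div, ENNReal.toReal_ofReal (by positivity : 0 ≤ ρ * T),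
    ENNReal.toReal_ofReal (integral_nonneg fun _ => norm_nonneg _)] at tr
  simp only [ENNReal.toReal_ofNat, Real.norm_eq_abs] at tr
  have : (∫ x, |f x|) * (volume B).toReal ≤ (2 * ρ * T) * (volume B).toReal := by linarith
  exact le_of_mul_le_mul_right this hb

lemma int_A {n : ℕ} {Φ : Rn1 n → ℝ} {A : Set (Rn n)} {η : Rn n → Rn1 n} (h : IsT Φ A η) (u : Rn n → ℝ) :
    ∫ x in A, (u x * divN (fun y => (η y).1) x + (η x).2) =
      ∫ x, (u x * divN (fun y => (η y).1) x + (η x).2) := by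
  refine setIntegral_eq_integral_of_forall_compl_eq_zero fun x hx => ?_
  have h1 : x ∉ tsupport η := fun hh => hx (h.2.2.1 hh)
  have h2 : x ∉ tsupport (fun y => (η y).1) := fun hh => h1 (fst_tsupport η hh)
  rw [divN_zero_of_notMem h2, image_eq_zero_of_notMem_tsupport h1]; simp

lemma int_V {n : ℕ} {A : Set (Rn n)} {η : Rn n → Rn n} (h : tsupport η ⊆ A) (u : Rn n → ℝ) :
    ∫ x in A, u x * divN η x = ∫ x, u x * divN η x := by
  refine setIntegral_eq_integral_of_forall_compl_eq_zero fun x hx => ?_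
  have h1 : x ∉ tsupport η := fun hh => hx (h hh)
  rw [divN_zero_of_notMem h1]; simp

lemma intOn_div {n : ℕ} {A : Set (Rn n)} {u : Rn n → ℝ} (hu : IntegrableOn u A) {η : Rn n → Rn n}
    (h1 : ContDiff ℝ 1 η) (h2 : HasCompactSupport η) : IntegrableOn (fun x => u x * divN η x) A := by
  obtain ⟨C, hC⟩ := (divN_compact h2).exists_bound_of_continuous (divN_continuous h1)
  exact hu.mul_bdd (c := C) (divN_continuous h1).aestronglyMeasurable (Eventually.of_forall hC)

lemma Gset_bdd {n : ℕ} {Φ : Rn1 n → ℝ} {c l : ℝ} (hF : NF Φ c l) {Ω A : Set (Rn n)} {u : Rn n → ℝ}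
    (hu : BVlocFun Ω u) (hA : CpCtd A Ω) : BddAbove (Gset Φ A u) := by
  obtain ⟨V, hV⟩ := hu.2 A hA
  have hAf : volume A ≠ ⊤ := (measure_mono subset_closure |>.trans_lt hA.2.1.measure_lt_top).ne
  refine ⟨c * V + c * volume.real A, ?_⟩
  rintro r ⟨η, h1, h2, h3, h4, rfl⟩
  have hT : IsT Φ A η := ⟨h1, h2, h3, h4⟩
  have hc := hF.hc
  have i1 := intOn_div (hu.1 A hA) hT.fst.1 hT.fst.2
  have i2 : IntegrableOn (fun x => (η x).2) A :=
    (hT.snd.1.continuous.integrable_of_hasCompactSupport hT.snd.2).integrableOn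
  rw [integral_add i1 i2]
  have b1 : ∫ x in A, u x * divN (fun y => (η y).1) x ≤ c * V := by
    have := hV ⟨fun x => c⁻¹ • (η x).1, ⟨hT.fst.1.const_smul _,
      hT.fst.2.smul_left (f := fun _ => c⁻¹), ?_, ?_⟩, rfl⟩
    · have e : ∀ x, u x * divN (fun x => c⁻¹ • (η x).1) x = c⁻¹ * (u x * divN (fun x => (η x).1) x) := by
        intro x
        rw [divN_smul (g := fun _ => c⁻¹) (hT.fst.1.differentiable (by norm_num) x) (by fun_prop)]
        simp; ring
      simp_rw [e] at this
      rw [integral_const_mul, inv_mul_le_iff₀ hc] at this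
      exact this
    · refine (closure_mono ?_).trans ((fst_tsupport η).trans h3)
      intro x hx hh
      exact hx (by simp only [hh, smul_zero])
    · intro x
      simp only [norm_smul, norm_inv, Real.norm_eq_abs, abs_of_pos hc]
      rw [inv_mul_le_iff₀ hc]; simpa using (hF.bd _ (h4 x)).1
  have b2 : ∫ x in A, (η x).2 ≤ c * volume.real A := by
    refine (le_abs_self _).trans ?_
    rw [← Real.norm_eq_abs]
    exact norm_setIntegral_le_of_norm_le_const (lt_top_iff_ne_top.2 hAf) fun x _ => (hF.bd _ (h4 x)).2
  linarith

lemma IsT_zero {n : ℕ} {Φ : Rn1 n → ℝ} {c l : ℝ} (hF : NF Φ c l) (A : Set (Rn n)) :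
    IsT Φ A (fun _ => 0) := by
  refine ⟨contDiff_const, HasCompactSupport.zero, ?_, fun _ => hF.zero⟩
  have : tsupport (fun _ : Rn n => (0 : Rn1 n)) = ∅ := by
    simp [tsupport]
  rw [this]; exact empty_subset _

lemma IsT.le_G {n : ℕ} {Φ : Rn1 n → ℝ} {A : Set (Rn n)} {η : Rn n → Rn1 n} (h : IsT Φ A η) {u : Rn n → ℝ}
    (hb : BddAbove (Gset Φ A u)) :
    ∫ x, (u x * divN (fun y => (η y).1) x + (η x).2) ≤ Gfun Φ u A := by
  rw [← int_A h]
  exact le_csSup hb ⟨η, h.1, h.2.1, h.2.2.1, h.2.2.2, rfl⟩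

lemma G_le {n : ℕ} {Φ : Rn1 n → ℝ} {c l : ℝ} (hF : NF Φ c l) {A : Set (Rn n)} {u : Rn n → ℝ} {K : ℝ}
    (h : ∀ η, IsT Φ A η → ∫ x, (u x * divN (fun y => (η y).1) x + (η x).2) ≤ K) : Gfun Φ u A ≤ K := by
  refine csSup_le ?_ ?_
  · obtain ⟨a, b, c, d⟩ := IsT_zero hF A
    exact ⟨_, _, a, b, c, d, rfl⟩
  · rintro r ⟨η, h1, h2, h3, h4, rfl⟩
    have hT : IsT Φ A η := ⟨h1, h2, h3, h4⟩
    rw [int_A hT]; exact h η hT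

lemma cp_ball {n : ℕ} {Ω : Set (Rn n)} {x0 : Rn n} {r s : ℝ} (h : Metric.closedBall x0 s ⊆ Ω) (hr : r ≤ s) :
    CpCtd (Metric.ball x0 r) Ω := by
  refine ⟨Metric.isOpen_ball, ?_, ?_⟩
  · exact (isCompact_closedBall x0 r).of_isClosed_subset isClosed_closure Metric.closure_ball_subset_closedBall
  · exact Metric.closure_ball_subset_closedBall.trans ((Metric.closedBall_subset_closedBall hr).trans h)

lemma IsT.mono {n : ℕ} {Φ : Rn1 n → ℝ} {A B : Set (Rn n)} {η : Rn n → Rn1 n} (h : IsT Φ A η) (hAB : A ⊆ B) :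
    IsT Φ B η := ⟨h.1, h.2.1, h.2.2.1.trans hAB, h.2.2.2⟩

lemma IsT.shift {n : ℕ} {Φ : Rn1 n → ℝ} {x0 : Rn n} {r ε : ℝ} {θ : Rn n → Rn1 n}
    (h : IsT Φ (Metric.ball x0 r) θ) {y : Rn n} (hy : ‖y‖ < ε) :
    IsT Φ (Metric.ball x0 (r + ε)) (fun x => θ (x + y)) := by
  refine ⟨h.1.comp (contDiff_id.add contDiff_const), h.2.1.comp_homeomorph (Homeomorph.addRight y), ?_,
    fun x => h.2.2.2 _⟩
  have : tsupport (fun x => θ (x + y)) ⊆ (fun x => x + y) ⁻¹' tsupport θ :=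
    closure_minimal (fun x hx => subset_tsupport _ hx) ((isClosed_tsupport θ).preimage (by fun_prop))
  intro x hx
  have h1 := h.2.2.1 (this hx)
  rw [Metric.mem_ball, dist_eq_norm] at *
  calc ‖x - x0‖ = ‖(x + y - x0) - y‖ := by congr 1; abel
    _ ≤ ‖x + y - x0‖ + ‖y‖ := norm_sub_le _ _
    _ < _ := by linarith

lemma caccioppoli {n : ℕ} {Φ : Rn1 n → ℝ} {c l : ℝ} (hF : NF Φ c l) {Ω : Set (Rn n)} {u : Rn n → ℝ}
    (hmin : MinG Φ Ω u) {x0 : Rn n} {R : ℝ} (hR : 0 < R) (hball : Metric.closedBall x0 (3 * R) ⊆ Ω)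
    {g : Rn n → ℝ} (hg : Integrable g) (hgm : Measurable g)
    (hgu : ∀ᵐ x, x ∈ Metric.ball x0 (3 * R) → g x = u x)
    {ζ : Rn n → ℝ} {γ : ℝ → ℝ} (hζ : ContDiff ℝ 1 ζ)
    (hζA : tsupport ζ ⊆ Metric.closedBall x0 R) (hζ0 : ∀ x, 0 ≤ ζ x) (hζ1 : ∀ x, ζ x ≤ 1)
    (hγ : ContDiff ℝ 2 γ) (hγ0 : ∀ t, 0 ≤ γ t) (hd0 : ∀ t, 0 ≤ deriv γ t) (hd1 : ∀ t, deriv γ t ≤ 1)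
    {M : ℝ} (hγM : ∀ t, γ t ≤ M) :
    TVb (fun x => ζ x * γ (g x)) (l⁻¹ * (c * (∫ x, ζ x * deriv γ (g x)) +
      (c + l) * (∫ x, γ (g x) * ‖fderiv ℝ ζ x‖))) := by
  have hζc : HasCompactSupport ζ :=
    (isCompact_closedBall x0 R).of_isClosed_subset (isClosed_tsupport _) hζA
  set W : ℝ → ℝ := fun r => Gfun Φ u (Metric.ball x0 (min r (3 * R))) with hW
  have hcp : ∀ r, CpCtd (Metric.ball x0 (min r (3 * R))) Ω := fun r => cp_ball hball (min_le_right _ _)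
  have hWm : Monotone W := by
    intro r s hrs
    refine G_le hF fun η hη => (hη.mono ?_).le_G (Gset_bdd hF hmin.1 (hcp s))
    exact Metric.ball_subset_ball (min_le_min_right _ hrs)
  obtain ⟨r, hr, hrR, hr2⟩ := (hWm.countable_not_continuousAt.dense_compl ℝ).exists_between
    (show R < 2 * R by linarith)
  have hcont : ContinuousAt W r := by simpa using hr
  set A := Metric.ball x0 r with hA
  have hWr : W r = Gfun Φ u A := by simp only [hW]; rw [min_eq_left (by linarith)]
  have hAcp : CpCtd A Ω := cp_ball hball (by linarith)
  have hpos : ∀ k : ℕ, (0:ℝ) < R * (1 / ((k:ℝ) + 1)) := fun k => by positivity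
  have hlim : Tendsto (fun k : ℕ => R * (1 / ((k:ℝ) + 1))) atTop (𝓝 0) := by
    simpa using (tendsto_one_div_add_atTop_nhds_zero_nat (𝕜 := ℝ)).const_mul R
  have hle : ∀ k : ℕ, R * (1 / ((k:ℝ) + 1)) ≤ R := by
    intro k
    refine mul_le_of_le_one_right hR.le ?_
    rw [div_le_one (by positivity)]
    have : (0:ℝ) ≤ k := by positivity
    linarith
  have hGk : Tendsto (fun k : ℕ => W (r + R * (1 / ((k:ℝ) + 1)))) atTop (𝓝 (Gfun Φ u A)) := by
    rw [← hWr]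
    refine hcont.tendsto.comp ?_
    simpa using hlim.const_add r
  have hζA' : tsupport ζ ⊆ A := hζA.trans (Metric.closedBall_subset_ball hrR)
  have hgu_int : ∀ {s : ℝ} {η : Rn n → Rn1 n}, s ≤ 3 * R → IsT Φ (Metric.ball x0 s) η → ∀ (w : Rn n → ℝ),
      ∫ x, ((g x - w x) * divN (fun y => (η y).1) x + (η x).2) =
      ∫ x, ((u x - w x) * divN (fun y => (η y).1) x + (η x).2) := by
    intro s η hs hη w
    refine integral_congr_ae ?_
    filter_upwards [hgu] with x hx
    by_cases h : x ∈ Metric.ball x0 (3 * R)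
    · rw [hx h]
    · have : x ∉ tsupport (fun y => (η y).1) := fun hh =>
        h (Metric.ball_subset_ball hs (hη.2.2.1 (fst_tsupport η hh)))
      rw [divN_zero_of_notMem this]; simp
  have hG : ∀ k : ℕ, ∀ θ, IsT Φ A θ → ∀ y : Rn n, ‖y‖ < R * (1 / ((k:ℝ) + 1)) →
      ∫ x, (g (x - y) * divN (fun y => (θ y).1) x + (θ x).2) ≤ W (r + R * (1 / ((k:ℝ) + 1))) := by
    intro k θ hθ y hy
    rw [← integral_add_right_eq_self _ y]
    have hs := hθ.shift hy
    have hk := hle k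
    have e := hgu_int (by linarith) hs (fun _ => 0)
    have e2 := hs.le_G (Gset_bdd hF hmin.1 (cp_ball hball (by linarith)))
    simp only [sub_zero] at e
    rw [← e] at e2
    simp only [hW]
    rw [min_eq_left (by linarith)]
    refine le_trans (le_of_eq ?_) e2
    congr 1
    ext x
    rw [divN_comp_add (fun x => (θ x).1) y x]; simp
  have L := fun (η : Rn n → Rn1 n) (hη : IsT Φ A η) (ξ : Rn n → Rn n) (hξ : ContDiff ℝ 1 ξ)
    (hξc : HasCompactSupport ξ) (hξ1 : ∀ x, ‖ξ x‖ ≤ 1) => limit_ineq hF hg hζ hζc hζA' hζ0 hζ1 hγ hγ0 hd0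
      hd1 hγM hpos hlim hGk hG hη hξ hξc hξ1
  set w : Rn n → ℝ := fun x => ζ x * γ (g x) with hw
  set G := Gfun Φ u A with hGdef
  set E := c * (∫ x, ζ x * deriv γ (g x)) + (c + l) * (∫ x, γ (g x) * ‖fderiv ℝ ζ x‖) with hE
  have hl := hF.hl
  have hwi : Integrable w := by
    refine (hζ.continuous.integrable_of_hasCompactSupport hζc).mul_bdd (c := M)
      (hγ.continuous.measurable.comp hgm).aestronglyMeasurable (Eventually.of_forall fun x => ?_)
    simp only [Function.comp, Real.norm_eq_abs]
    rw [abs_of_nonneg (hγ0 _)]; exact hγM _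
  have hwc : tsupport w ⊆ tsupport ζ := closure_mono fun x hx hh => hx (by simp [hw, hh])
  have TV0 : ∀ ξ : Rn n → Rn n, ContDiff ℝ 1 ξ → HasCompactSupport ξ → (∀ x, ‖ξ x‖ ≤ 1) →
      ∫ x, w x * divN ξ x ≤ l⁻¹ * (G + E) := by
    intro ξ h1 h2 h3
    have := L _ (IsT_zero hF A) ξ h1 h2 h3
    have e : ∫ x, ((g x - w x) * divN (fun _ : Rn n => (0 : Rn1 n).1) x + (0 : Rn1 n).2) = 0 := by
      simp [divN]
    rw [le_inv_mul_iff₀ hl]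
    simp only [hE]
    linarith
  set v : Rn n → ℝ := fun x => u x - w x with hv
  have hvBV : BVlocFun Ω v := by
    refine ⟨fun B hB => (hmin.1.1 B hB).sub hwi.integrableOn, fun B hB => ?_⟩
    obtain ⟨V, hV⟩ := hmin.1.2 B hB
    refine ⟨V + l⁻¹ * (G + E), ?_⟩
    rintro _ ⟨η, hη, rfl⟩
    have i1 := intOn_div (hmin.1.1 B hB) hη.1 hη.2.1
    have i2 := intOn_div (hwi.integrableOn (s := B)) hη.1 hη.2.1
    have e : ∫ x in B, v x * divN η x = (∫ x in B, u x * divN η x) - ∫ x in B, w x * divN η x := by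
      rw [← integral_sub i1 i2]; simp only [hv, sub_mul]
    rw [e]
    have b1 := hV ⟨η, hη, rfl⟩
    have b2 := TV0 (fun x => - η x) hη.1.neg hη.2.1.neg (by simpa using hη.2.2.2)
    have e2 : ∫ x, w x * divN (fun x => - η x) x = - ∫ x in B, w x * divN η x := by
      rw [int_V hη.2.2.1, ← integral_neg]
      congr 1; ext x; rw [divN_neg]; ring
    linarith
  have hsupp : CptSupp A (fun x => u x - v x) := by
    have : (fun x => u x - v x) = w := by ext x; simp [hv]
    rw [this]
    exact ⟨hζc.of_isClosed_subset (isClosed_tsupport _) hwc, hwc.trans hζA'⟩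
  have hm := hmin.2 A hAcp v hvBV hsupp
  intro ξ h1 h2 h3
  have hv2 : Gfun Φ v A ≤ G + E - l * ∫ x, w x * divN ξ x := by
    refine G_le hF fun η hη => ?_
    have := L η hη ξ h1 h2 h3
    have e := hgu_int (by linarith) hη w
    simp only [hv]
    rw [← e]
    simp only [hE]
    linarith
  rw [le_inv_mul_iff₀ hl]
  linarith

lemma sT_deriv_nonneg (t : ℝ) : 0 ≤ deriv Real.smoothTransition t :=
  Real.smoothTransition.monotone.deriv_nonneg

lemma sT_deriv_zero {t : ℝ} (ht : t ≤ 0) : deriv Real.smoothTransition t = 0 := by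
  apply IsLocalMin.deriv_eq_zero
  refine Eventually.of_forall fun s => ?_
  rw [Real.smoothTransition.zero_of_nonpos ht]
  exact Real.smoothTransition.nonneg s

lemma sT_deriv_bdd : ∃ K : ℝ, 1 ≤ K ∧ ∀ t, deriv Real.smoothTransition t ≤ K := by
  have hc : Continuous (deriv Real.smoothTransition) :=
    (Real.smoothTransition.contDiff (n := 1)).continuous_deriv (by norm_num)
  obtain ⟨C, hC⟩ := (isCompact_Icc (a := (0:ℝ)) (b := 1)).exists_bound_of_continuousOn hc.continuousOn
  refine ⟨max C 1, le_max_right _ _, fun t => ?_⟩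
  rcases le_total t 0 with h | h
  · rw [sT_deriv_zero h]; exact zero_le_one.trans (le_max_right _ _)
  · rcases le_total t 1 with h1 | h1
    · exact (le_abs_self _).trans ((hC t ⟨h, h1⟩).trans (le_max_left _ _))
    · have : deriv Real.smoothTransition t = 0 := by
        apply IsLocalMax.deriv_eq_zero
        refine Eventually.of_forall fun s => ?_
        rw [Real.smoothTransition.one_of_one_le h1]
        exact Real.smoothTransition.le_one s
      rw [this]; exact zero_le_one.trans (le_max_right _ _)

lemma TVb.mono {n : ℕ} {f : Rn n → ℝ} {T T' : ℝ} (h : TVb f T) (hT : T ≤ T') : TVb f T' :=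
  fun ξ h1 h2 h3 => (h ξ h1 h2 h3).trans hT

lemma one_step {n : ℕ} {Φ : Rn1 n → ℝ} {c l : ℝ} (hF : NF Φ c l) {Ω : Set (Rn n)} {u : Rn n → ℝ}
    (hmin : MinG Φ Ω u) {x0 : Rn n} {R : ℝ} (hR : 0 < R) (hball : Metric.closedBall x0 (3 * R) ⊆ Ω)
    {g : Rn n → ℝ} (hg : Integrable g) (hgm : Measurable g)
    (hgu : ∀ᵐ x, x ∈ Metric.ball x0 (3 * R) → g x = u x)
    {K : ℝ} (hK : 1 ≤ K) (hKS : ∀ t, deriv Real.smoothTransition t ≤ K)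
    {h δ q q' ρ : ℝ} (hδ : 0 < δ) (hq : q' < q) (hqR : q ≤ R ^ 2) (hρ : 0 < ρ)
    (hvol : 2 * volume ({x | h < g x} ∩ {x | ‖x - x0‖ ^ 2 ≤ q}) ≤ volume (Metric.ball (0 : Rn n) ρ)) :
    (δ / K) * volume.real ({x | h + δ < g x} ∩ {x | ‖x - x0‖ ^ 2 ≤ q'}) ≤
      2 * ρ * (l⁻¹ * (c + (c + l) * (δ * (2 * R / (q - q')))) *
        volume.real ({x | h < g x} ∩ {x | ‖x - x0‖ ^ 2 ≤ q})) := by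
  have hK0 : 0 < K := by linarith
  have hc := hF.hc
  have hl := hF.hl
  have hqq : 0 < q - q' := by linarith
  set E := {x | h < g x} ∩ {x | ‖x - x0‖ ^ 2 ≤ q} with hE
  set E' := {x | h + δ < g x} ∩ {x | ‖x - x0‖ ^ 2 ≤ q'} with hE'
  have hEm : MeasurableSet E :=
    (measurableSet_lt measurable_const hgm).inter (measurableSet_le (by fun_prop) measurable_const)
  have hEm' : MeasurableSet E' :=
    (measurableSet_lt measurable_const hgm).inter (measurableSet_le (by fun_prop) measurable_const)
  have hQR : ∀ x, ‖x - x0‖ ^ 2 ≤ q → ‖x - x0‖ ≤ R := fun x hx =>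
    le_of_sq_le_sq (hx.trans hqR) hR.le
  have hEb : E ⊆ Metric.closedBall x0 R := fun x hx => by
    rw [Metric.mem_closedBall, dist_eq_norm]; exact hQR x hx.2
  have hEfin : volume E ≠ ⊤ := ((measure_mono hEb).trans_lt measure_closedBall_lt_top).ne
  have hE'E : E' ⊆ E := fun x hx => ⟨lt_trans (lt_add_of_pos_right h hδ) hx.1, le_trans hx.2 hq.le⟩
  have hE'fin : volume E' ≠ ⊤ := ((measure_mono hE'E).trans_lt (lt_top_iff_ne_top.2 hEfin)).ne
  set S := Real.smoothTransition with hS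
  have hSd : Differentiable ℝ S := (Real.smoothTransition.contDiff (n := 1)).differentiable (by norm_num)
  have hS2 : ContDiff ℝ 2 S := Real.smoothTransition.contDiff (n := 2)
  have hS1 : ContDiff ℝ 1 S := Real.smoothTransition.contDiff (n := 1)
  set γ : ℝ → ℝ := fun t => (δ / K) * S ((t - h) / δ) with hγdef
  set ζ : Rn n → ℝ := fun x => S ((q - ‖x - x0‖ ^ 2) / (q - q')) with hζdef
  have hγ : ContDiff ℝ 2 γ :=
    contDiff_const.mul (hS2.comp ((contDiff_id.sub contDiff_const).div_const _))
  have hζ : ContDiff ℝ 1 ζ :=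
    hS1.comp ((contDiff_const.sub ((contDiff_id.sub contDiff_const).norm_sq ℝ)).div_const _)
  have hγ' : ∀ t, deriv γ t = deriv S ((t - h) / δ) / K := by
    intro t
    have h1 : HasDerivAt (fun t : ℝ => (t - h) / δ) (1 / δ) t := ((hasDerivAt_id t).sub_const h).div_const δ
    have h2 := ((hSd ((t - h) / δ)).hasDerivAt.comp t h1).const_mul (δ / K)
    have h3 : deriv γ t = _ := h2.deriv
    rw [h3]; field_simp
  have hγ0 : ∀ t, 0 ≤ γ t := fun t => mul_nonneg (by positivity) (Real.smoothTransition.nonneg _)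
  have hγM : ∀ t, γ t ≤ δ / K := fun t =>
    mul_le_of_le_one_right (by positivity) (Real.smoothTransition.le_one _)
  have hd0 : ∀ t, 0 ≤ deriv γ t := fun t => by
    rw [hγ']; exact div_nonneg (sT_deriv_nonneg _) hK0.le
  have hd1 : ∀ t, deriv γ t ≤ 1 := fun t => by
    rw [hγ', div_le_one hK0]; exact hKS _
  have hγz : ∀ t, t ≤ h → γ t = 0 ∧ deriv γ t = 0 := by
    intro t ht
    have h1 : (t - h) / δ ≤ 0 := div_nonpos_of_nonpos_of_nonneg (by linarith) hδ.le
    rw [hγ', hS, sT_deriv_zero h1]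
    simp [hγdef, hS, Real.smoothTransition.zero_of_nonpos h1]
  have hγtop : ∀ t, h + δ < t → γ t = δ / K := by
    intro t ht
    have h1 : 1 ≤ (t - h) / δ := by rw [le_div_iff₀ hδ]; linarith
    simp [hγdef, hS, Real.smoothTransition.one_of_one_le h1]
  have hζ0 : ∀ x, 0 ≤ ζ x := fun x => Real.smoothTransition.nonneg _
  have hζ1 : ∀ x, ζ x ≤ 1 := fun x => Real.smoothTransition.le_one _
  have hζz : ∀ x, ¬ ‖x - x0‖ ^ 2 ≤ q → ζ x = 0 := by
    intro x hx
    exact Real.smoothTransition.zero_of_nonpos (div_nonpos_of_nonpos_of_nonneg (by linarith) hqq.le)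
  have hζtop : ∀ x, ‖x - x0‖ ^ 2 ≤ q' → ζ x = 1 := by
    intro x hx
    refine Real.smoothTransition.one_of_one_le ?_
    rw [le_div_iff₀ hqq]; linarith
  have hζA : tsupport ζ ⊆ Metric.closedBall x0 R := by
    refine closure_minimal (fun x hx => ?_) Metric.isClosed_closedBall
    rw [Metric.mem_closedBall, dist_eq_norm]
    by_contra hh
    exact hx (hζz x fun h => hh (hQR x h))
  have hζf : ∀ x, fderiv ℝ ζ x = deriv S ((q - ‖x - x0‖ ^ 2) / (q - q')) •
      ((q - q')⁻¹ • (-((2:ℝ) • (innerSL ℝ (x - x0) : Rn n →L[ℝ] ℝ)))) := by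
    intro x
    have h1 : HasFDerivAt (fun x : Rn n => ‖x - x0‖ ^ 2) ((2:ℝ) • (innerSL ℝ (x - x0) : Rn n →L[ℝ] ℝ)) x := by
      have := ((hasFDerivAt_id x).sub_const x0).norm_sq
      have e : ((2:ℝ) • (innerSL ℝ (x - x0) : Rn n →L[ℝ] ℝ)) =
          2 • ((innerSL ℝ (id x - x0)) ∘SL ContinuousLinearMap.id ℝ (Rn n)) := by
        ext v; simp
      rw [e]; exact this
    have h2 : HasFDerivAt (fun x : Rn n => (q - ‖x - x0‖ ^ 2) / (q - q'))
        ((q - q')⁻¹ • (-((2:ℝ) • (innerSL ℝ (x - x0) : Rn n →L[ℝ] ℝ)))) x := by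
      have := (h1.const_sub q).const_mul (q - q')⁻¹
      simpa [div_eq_inv_mul] using this
    exact ((hSd _).hasDerivAt.comp_hasFDerivAt x h2).fderiv
  have hζn : ∀ x, ‖fderiv ℝ ζ x‖ ≤ if ‖x - x0‖ ^ 2 ≤ q then K * (2 * R / (q - q')) else 0 := by
    intro x
    rw [hζf]
    split_ifs with hx
    · rw [norm_smul, norm_smul, norm_neg, norm_smul, innerSL_apply_norm, Real.norm_of_nonneg (sT_deriv_nonneg _)]
      have := hQR x hx
      refine mul_le_mul (hKS _) ?_ (by positivity) hK0.le
      rw [norm_inv, Real.norm_of_nonneg hqq.le, ← div_eq_inv_mul]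
      simp only [Real.norm_ofNat]
      gcongr
    · rw [hS, sT_deriv_zero (div_nonpos_of_nonpos_of_nonneg (by linarith) hqq.le)]; simp
  have TV1 := caccioppoli hF hmin hR hball hg hgm hgu hζ hζA hζ0 hζ1 hγ hγ0 hd0 hd1 hγM
  have hind : ∀ k : ℝ, Integrable (E.indicator fun _ : Rn n => k) := fun k =>
    (integrable_indicator_iff hEm).2 (integrableOn_const hEfin)
  have I1 : ∫ x, ζ x * deriv γ (g x) ≤ volume.real E := by
    have : ∫ x, E.indicator (fun _ => (1:ℝ)) x = volume.real E := by
      rw [integral_indicator_const _ hEm]; simp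
    rw [← this]
    refine integral_mono_of_nonneg (Eventually.of_forall fun x => mul_nonneg (hζ0 _) (hd0 _)) (hind 1)
      (Eventually.of_forall fun x => ?_)
    simp only [indicator]
    split_ifs with hx
    · exact mul_le_one₀ (hζ1 x) (hd0 _) (hd1 _)
    · rw [hE, mem_inter_iff, not_and_or] at hx
      rcases hx with hx | hx
      · rw [(hγz _ (not_lt.1 hx)).2]; simp
      · rw [hζz _ hx]; simp
  have I2 : ∫ x, γ (g x) * ‖fderiv ℝ ζ x‖ ≤ (δ * (2 * R / (q - q'))) * volume.real E := by
    have : ∫ x, E.indicator (fun _ => δ * (2 * R / (q - q'))) x =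
        (δ * (2 * R / (q - q'))) * volume.real E := by
      rw [integral_indicator_const _ hEm]; simp [mul_comm]
    rw [← this]
    refine integral_mono_of_nonneg (Eventually.of_forall fun x => mul_nonneg (hγ0 _) (norm_nonneg _)) (hind _)
      (Eventually.of_forall fun x => ?_)
    simp only [indicator]
    have hn := hζn x
    split_ifs with hx
    · rw [if_pos (show ‖x - x0‖ ^ 2 ≤ q from hx.2)] at hn
      calc γ (g x) * ‖fderiv ℝ ζ x‖ ≤ (δ / K) * (K * (2 * R / (q - q'))) :=
            mul_le_mul (hγM _) hn (norm_nonneg _) (by positivity)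
        _ = _ := by field_simp
    · rw [hE, mem_inter_iff, not_and_or] at hx
      rcases hx with hx | hx
      · rw [(hγz _ (not_lt.1 hx)).1]; simp
      · rw [if_neg (show ¬ ‖x - x0‖ ^ 2 ≤ q from hx)] at hn
        rw [le_antisymm hn (norm_nonneg _)]; simp
  have TV2 : TVb (fun x => ζ x * γ (g x))
      (l⁻¹ * (c + (c + l) * (δ * (2 * R / (q - q')))) * volume.real E) := by
    refine TV1.mono ?_
    rw [mul_assoc]
    refine mul_le_mul_of_nonneg_left ?_ (by positivity)
    have a1 := mul_le_mul_of_nonneg_left I1 hc.le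
    have a2 := mul_le_mul_of_nonneg_left I2 (by positivity : 0 ≤ c + l)
    linarith
  have hfm : Measurable (fun x => ζ x * γ (g x)) :=
    hζ.continuous.measurable.mul (hγ.continuous.measurable.comp hgm)
  have hfb : ∀ x, ζ x * γ (g x) ≤ E.indicator (fun _ => δ / K) x := by
    intro x
    simp only [indicator]
    split_ifs with hx
    · exact (mul_le_of_le_one_left (hγ0 _) (hζ1 _)).trans (hγM _)
    · rw [hE, mem_inter_iff, not_and_or] at hx
      rcases hx with hx | hx
      · rw [(hγz _ (not_lt.1 hx)).1]; simp
      · rw [hζz _ hx]; simp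
  have hf0 : ∀ x, 0 ≤ ζ x * γ (g x) := fun x => mul_nonneg (hζ0 _) (hγ0 _)
  have hfi : Integrable (fun x => ζ x * γ (g x)) := by
    refine (hind (δ / K)).mono' hfm.aestronglyMeasurable (Eventually.of_forall fun x => ?_)
    rw [Real.norm_of_nonneg (hf0 x)]; exact hfb x
  have hsub : {x | ζ x * γ (g x) ≠ 0} ⊆ E := by
    intro x hx
    by_contra hh
    have := hfb x
    rw [indicator_of_notMem hh] at this
    exact hx (le_antisymm this (hf0 x))
  have P := poincare hfi hfm TV2 (by positivity) hρ (le_trans (by gcongr) hvol)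
  refine le_trans ?_ P
  have : ∫ x, E'.indicator (fun _ => δ / K) x = (δ / K) * volume.real E' := by
    rw [integral_indicator_const _ hEm']; simp [mul_comm]
  rw [← this]
  refine integral_mono ((integrable_indicator_iff hEm').2 (integrableOn_const hE'fin)) hfi.abs fun x => ?_
  simp only [indicator]
  split_ifs with hx
  · rw [hζtop x hx.2, hγtop _ hx.1, one_mul]; exact le_abs_self _
  · exact abs_nonneg _

lemma upper_bound {n : ℕ} {Φ : Rn1 n → ℝ} {c l : ℝ} (hF : NF Φ c l) {Ω : Set (Rn n)} {u : Rn n → ℝ}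
    (hmin : MinG Φ Ω u) {x0 : Rn n} {R : ℝ} (hR : 0 < R) (hball : Metric.closedBall x0 (3 * R) ⊆ Ω) :
    ∃ M : ℝ, ∀ᵐ x, x ∈ Metric.ball x0 (R / 2) → u x ≤ M := by
  have hui : Integrable ((Metric.ball x0 (3 * R)).indicator u) :=
    (integrable_indicator_iff measurableSet_ball).2 (hmin.1.1 _ (cp_ball hball le_rfl))
  obtain ⟨g, hgm, hgae⟩ := hui.aestronglyMeasurable
  have hg : Integrable g := hui.congr hgae
  replace hgm : Measurable g := hgm.measurable
  have hgu : ∀ᵐ x, x ∈ Metric.ball x0 (3 * R) → g x = u x := by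
    filter_upwards [hgae] with x hx hxb
    rw [← hx, indicator_of_mem hxb]
  obtain ⟨K, hK, hKS⟩ := sT_deriv_bdd
  have hK0 : 0 < K := by linarith
  have hc := hF.hc
  have hl := hF.hl
  set C := l⁻¹ * (c + (c + l) * (8 / R)) with hC
  have hC0 : 0 < C := by positivity
  set ρ := (1 / 2 : ℝ) ^ (n + 1) / (2 * K * C) with hρdef
  have hρ : 0 < ρ := by positivity
  have hρe : 2 * K * C * ρ = (1 / 2 : ℝ) ^ (n + 1) := by rw [hρdef]; field_simp
  set V := volume.real (Metric.ball (0 : Rn n) ρ) with hV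
  have hV0 : 0 < V := ENNReal.toReal_pos (Metric.measure_ball_pos volume _ hρ).ne' measure_ball_lt_top.ne
  set h0 := 2 * (∫ x, |g x|) / V + 1 with hh0
  have hI0 : 0 ≤ ∫ x, |g x| := integral_nonneg fun _ => abs_nonneg _
  have hh0p : 0 < h0 := by positivity
  set a : ℕ → ℝ := fun j => (1 / 2 : ℝ) ^ j with ha
  have ha0 : ∀ j, 0 < a j := fun j => by positivity
  have ha1 : ∀ j, a (j + 1) = a j / 2 := fun j => by simp only [ha, pow_succ]; ring
  have hale : ∀ j, a j ≤ 1 := fun j => pow_le_one₀ (by norm_num) (by norm_num)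
  set H : ℕ → ℝ := fun j => h0 + 2 - 2 * a j with hH
  set q : ℕ → ℝ := fun j => R ^ 2 / 2 + R ^ 2 / 2 * a j with hq
  set E : ℕ → Set (Rn n) := fun j => {x | H j < g x} ∩ {x | ‖x - x0‖ ^ 2 ≤ q j} with hE
  have hqR : ∀ j, q j ≤ R ^ 2 := by
    intro j
    have := mul_le_of_le_one_right (by positivity : 0 ≤ R ^ 2 / 2) (hale j)
    simp only [hq]; linarith
  have hEfin : ∀ j, volume (E j) ≠ ⊤ := by
    intro j
    have hEb : E j ⊆ Metric.closedBall x0 R := fun x hx => by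
      rw [Metric.mem_closedBall, dist_eq_norm]
      exact le_of_sq_le_sq (le_trans hx.2 (hqR j)) hR.le
    exact ((measure_mono hEb).trans_lt measure_closedBall_lt_top).ne
  set m : ℕ → ℝ := fun j => volume.real (E j) with hm
  have hm0 : 2 * m 0 ≤ V := by
    have h1 := mul_meas_ge_le_integral_of_nonneg (μ := volume) (f := fun x => |g x|)
      (Eventually.of_forall fun _ => abs_nonneg _) hg.abs h0
    have hfin : volume {x | h0 ≤ |g x|} ≠ ⊤ := by
      have := hg.measure_norm_ge_lt_top hh0p
      exact this.ne
    have h2 : m 0 ≤ volume.real {x | h0 ≤ |g x|} := by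
      refine measureReal_mono ?_ hfin
      intro x hx
      have h3 : H 0 < g x := hx.1
      simp only [hH, ha, pow_zero] at h3
      have := le_abs_self (g x)
      change h0 ≤ |g x|
      linarith
    have h3 : h0 * m 0 ≤ ∫ x, |g x| := (mul_le_mul_of_nonneg_left h2 hh0p.le).trans h1
    have h4 : h0 * V = 2 * (∫ x, |g x|) + V := by rw [hh0]; field_simp
    have h5 : h0 * (2 * m 0) ≤ h0 * V := by linarith
    exact le_of_mul_le_mul_left h5 hh0p
  have hVj : ∀ j, volume.real (Metric.ball (0 : Rn n) (a j * ρ)) = a j ^ n * V := by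
    intro j
    rw [measureReal_def, Measure.addHaar_ball_mul_of_pos _ _ (ha0 j), ENNReal.toReal_mul,
      ENNReal.toReal_ofReal (by positivity)]
    simp [hV, measureReal_def]
  have claim : ∀ j, m j ≤ a j ^ (n + 1) * m 0 := by
    intro j
    induction j with
    | zero => simp [ha]
    | succ j ih =>
      have hmnn : 0 ≤ m 0 := measureReal_nonneg
      have hle : 2 * m j ≤ a j ^ n * V := by
        have e1 : a j ^ (n + 1) ≤ a j ^ n := pow_le_pow_of_le_one (ha0 j).le (hale j) (Nat.le_succ n)
        calc 2 * m j ≤ a j ^ (n + 1) * (2 * m 0) := by linarith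
          _ ≤ a j ^ n * V := mul_le_mul e1 hm0 (by positivity) (by have := ha0 j; positivity)
      have hvol : 2 * volume (E j) ≤ volume (Metric.ball (0 : Rn n) (a j * ρ)) := by
        rw [← ENNReal.toReal_le_toReal (ENNReal.mul_ne_top (by simp) (hEfin j)) measure_ball_lt_top.ne,
          ENNReal.toReal_mul]
        have := hVj j
        rw [measureReal_def] at this
        rw [this]
        exact hle
      have haj := ha0 j
      have hqq : q j - q (j + 1) = R ^ 2 / 4 * a j := by simp only [hq, ha1]; ring
      have st := one_step hF hmin hR hball hg hgm hgu hK hKS (h := H j) (δ := a j) (q := q j) (q' := q (j + 1))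
        (ρ := a j * ρ) haj (by have : 0 < R ^ 2 / 4 * a j := by positivity
                               linarith) (hqR j) (by positivity) hvol
      have hHH : H j + a j = H (j + 1) := by simp only [hH, ha1]; ring
      rw [hHH, hqq] at st
      have hCe : a j * (2 * R / (R ^ 2 / 4 * a j)) = 8 / R := by field_simp; norm_num
      rw [hCe] at st
      have st' : a j / K * m (j + 1) ≤ 2 * (a j * ρ) * (C * m j) := st
      have e2 : m (j + 1) ≤ (1 / 2 : ℝ) ^ (n + 1) * m j := by
        rw [← hρe]
        have : a j / K * m (j + 1) ≤ a j / K * (2 * K * C * ρ * m j) := by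
          refine st'.trans (le_of_eq ?_)
          field_simp
        exact le_of_mul_le_mul_left this (by positivity)
      refine e2.trans ?_
      calc (1 / 2 : ℝ) ^ (n + 1) * m j ≤ (1 / 2 : ℝ) ^ (n + 1) * (a j ^ (n + 1) * m 0) := by gcongr
        _ = a (j + 1) ^ (n + 1) * m 0 := by
          rw [ha1, ← mul_assoc, ← mul_pow]; congr 2; ring
  set F := {x | h0 + 2 < g x} ∩ {x | ‖x - x0‖ ^ 2 ≤ R ^ 2 / 2} with hFdef
  have hFE : ∀ j, F ⊆ E j := by
    intro j x hx
    have h1 : h0 + 2 < g x := hx.1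
    have h2 : ‖x - x0‖ ^ 2 ≤ R ^ 2 / 2 := hx.2
    have h3 := ha0 j
    have h4 : 0 < R ^ 2 / 2 * a j := by positivity
    refine ⟨?_, ?_⟩
    · change H j < g x
      simp only [hH]; linarith
    · change ‖x - x0‖ ^ 2 ≤ q j
      simp only [hq]; linarith
  have hFm : volume.real F ≤ 0 := by
    have ht : Tendsto (fun j => a j ^ (n + 1) * m 0) atTop (𝓝 0) := by
      have h1 : Tendsto a atTop (𝓝 0) := tendsto_pow_atTop_nhds_zero_of_lt_one (by norm_num) (by norm_num)
      simpa using (h1.pow (n + 1)).mul_const (m 0)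
    refine ge_of_tendsto' ht fun j => ?_
    exact (measureReal_mono (hFE j) (hEfin j)).trans (claim j)
  have hF0 : volume F = 0 := by
    have hfin : volume F ≠ ⊤ := ((measure_mono (hFE 0)).trans_lt (lt_top_iff_ne_top.2 (hEfin 0))).ne
    have := le_antisymm hFm measureReal_nonneg
    rwa [measureReal_eq_zero_iff hfin] at this
  refine ⟨h0 + 2, ?_⟩
  filter_upwards [hgu, measure_eq_zero_iff_ae_notMem.1 hF0] with x hx1 hx2 hxb
  rw [Metric.mem_ball, dist_eq_norm] at hxb
  have hb3 : x ∈ Metric.ball x0 (3 * R) := by rw [Metric.mem_ball, dist_eq_norm]; linarith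
  rw [← hx1 hb3]
  by_contra hh
  refine hx2 ⟨not_le.1 hh, ?_⟩
  change ‖x - x0‖ ^ 2 ≤ R ^ 2 / 2
  nlinarith [norm_nonneg (x - x0)]

lemma flip_Phi {n : ℕ} {Φ : Rn1 n → ℝ} (hΦ : IsNorm1 Φ) (hmono : PartMono Φ) (p : Rn1 n) :
    Φ (-p.1, p.2) ≤ Φ p := by
  refine hmono _ _ (le_of_eq ?_) le_rfl
  have := hΦ.2.1 (-1) (p.1, 0)
  simpa using this

lemma flip_IsT {n : ℕ} {Φ : Rn1 n → ℝ} (hΦ : IsNorm1 Φ) (hmono : PartMono Φ) {A : Set (Rn n)}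
    {η : Rn n → Rn1 n} (h : IsT Φ A η) : IsT Φ A (fun x => (-(η x).1, (η x).2)) := by
  refine ⟨h.fst.1.neg.prodMk h.snd.1, h.2.1.comp_left (g := fun p : Rn1 n => (-p.1, p.2)) (by simp), ?_,
    fun x => (flip_Phi hΦ hmono _).trans (h.2.2.2 x)⟩
  refine (closure_mono ?_).trans h.2.2.1
  intro x hx hh
  exact hx (by simp [hh])

lemma flip_G {n : ℕ} {Φ : Rn1 n → ℝ} (hΦ : IsNorm1 Φ) (hmono : PartMono Φ) (A : Set (Rn n)) (u : Rn n → ℝ) :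
    Gfun Φ (fun x => - u x) A = Gfun Φ u A := by
  have key : ∀ u : Rn n → ℝ, Gset Φ A u ⊆ Gset Φ A (fun x => - u x) := by
    rintro u r ⟨η, h1, h2, h3, h4, rfl⟩
    obtain ⟨a, b, c, d⟩ := flip_IsT hΦ hmono (⟨h1, h2, h3, h4⟩ : IsT Φ A η)
    refine ⟨_, a, b, c, d, ?_⟩
    congr 1
    ext x
    simp only
    rw [divN_neg (η := fun y => (η y).1)]; ring
  unfold Gfun
  congr 1
  refine Subset.antisymm ?_ (key u)
  have := key (fun x => - u x)
  simpa using this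

lemma flip_BV {n : ℕ} {Ω : Set (Rn n)} {u : Rn n → ℝ} (h : BVlocFun Ω u) : BVlocFun Ω (fun x => - u x) := by
  refine ⟨fun A hA => (h.1 A hA).neg, fun A hA => (h.2 A hA).mono ?_⟩
  rintro r ⟨η, ⟨h1, h2, h3, h4⟩, rfl⟩
  refine ⟨fun x => - η x, ⟨h1.neg, h2.neg, ?_, by simpa using h4⟩, ?_⟩
  · refine (closure_mono ?_).trans h3
    intro x hx hh
    exact hx (by simp [hh])
  · congr 1
    ext x
    rw [divN_neg]; ring

lemma flip_Min {n : ℕ} {Φ : Rn1 n → ℝ} (hΦ : IsNorm1 Φ) (hmono : PartMono Φ) {Ω : Set (Rn n)} {u : Rn n → ℝ}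
    (h : MinG Φ Ω u) : MinG Φ Ω (fun x => - u x) := by
  refine ⟨flip_BV h.1, fun A hA v hv hs => ?_⟩
  rw [flip_G hΦ hmono, ← flip_G hΦ hmono A v]
  refine h.2 A hA _ (flip_BV hv) ?_
  have e : tsupport (fun x => u x - - v x) ⊆ tsupport (fun x => - u x - v x) := by
    refine closure_mono ?_
    intro x hx hh
    exact hx (by simp only at hh ⊢; linarith)
  exact ⟨hs.1.of_isClosed_subset (isClosed_tsupport _) e, e.trans hs.2⟩

end Helpers

theorem minG_locally_bounded {n : ℕ} (Φ : Rn1 n → ℝ) (hΦ : IsNorm1 Φ)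
    (hmono : PartMono Φ) (Ω : Set (Rn n)) (hΩ : IsOpen Ω) (u : Rn n → ℝ)
    (hmin : MinG Φ Ω u) :
    ∀ A, CpCtd A Ω → ∃ M > (0:ℝ), ∀ᵐ x ∂(volume : Measure (Rn n)),
      x ∈ A → |u x| ≤ M := by
  intro A hA
  obtain ⟨c, hc, l, hl, h1, h2, h3, h4⟩ := norm1_facts hΦ
  have hF : NF Φ c l := ⟨hc, hl, h1, h2, h3, h4⟩
  suffices hs : ∃ M > (0:ℝ), ∀ᵐ x ∂(volume : Measure (Rn n)), x ∈ closure A → |u x| ≤ M by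
    obtain ⟨M, hM, h⟩ := hs
    exact ⟨M, hM, h.mono fun x hx hxA => hx (subset_closure hxA)⟩
  refine hA.2.1.induction_on
    (p := fun s => ∃ M > (0:ℝ), ∀ᵐ x ∂(volume : Measure (Rn n)), x ∈ s → |u x| ≤ M) ?_ ?_ ?_ ?_
  · exact ⟨1, one_pos, by simp⟩
  · rintro s t hst ⟨M, hM, h⟩
    exact ⟨M, hM, h.mono fun x hx hxs => hx (hst hxs)⟩
  · rintro s t ⟨M, hM, h⟩ ⟨M', hM', h'⟩
    refine ⟨max M M', lt_max_of_lt_left hM, ?_⟩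
    filter_upwards [h, h'] with x hx hx' hxs
    rcases hxs with hxs | hxs
    · exact (hx hxs).trans (le_max_left _ _)
    · exact (hx' hxs).trans (le_max_right _ _)
  · intro x0 hx0
    obtain ⟨r, hr, hrb⟩ := Metric.isOpen_iff.1 hΩ x0 (hA.2.2 hx0)
    have hR : 0 < r / 4 := by positivity
    have hb : Metric.closedBall x0 (3 * (r / 4)) ⊆ Ω :=
      (Metric.closedBall_subset_ball (by linarith)).trans hrb
    obtain ⟨M, hM⟩ := upper_bound hF hmin hR hb
    obtain ⟨M', hM'⟩ := upper_bound hF (flip_Min hΦ hmono hmin) hR hb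
    refine ⟨Metric.ball x0 (r / 4 / 2), mem_nhdsWithin_of_mem_nhds (Metric.ball_mem_nhds _ (by positivity)),
      max (max M M') 1, lt_max_of_lt_right one_pos, ?_⟩
    filter_upwards [hM, hM'] with x hx hx' hxb
    have a1 := hx hxb
    have a2 := hx' hxb
    have b1 := le_max_left M M'
    have b2 := le_max_right M M'
    have b3 := le_max_left (max M M') 1
    rw [abs_le]
    constructor <;> linarith
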